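/- Let H:ℝ→[0,∞) be a symmetric convex function with H(x)=x²/4 for |x|≤2t₀ for some t₀>0, whose Fenchel–Legendre transform H* satisfies lim_{x→∞}H*(x)/x=∞, and suppose there exist A∈[1,∞) and α∈(1,2] with H(sx)≤A s^α H(x) for all x∈ℝ and s∈[0,1]. If a probability measure μ on ℝ satisfies ∫_ℝ e^{s|x|} dμ(x)<∞ for every s>0 and Ent_μ(e^φ) ≤ ∫_ℝ H(c φ′) e^φ dμ for some c>0 and all smooth convex Lipschitz functions φ:ℝ→ℝ, then μ satisfies T̄⁻(H*(a·)) with a = ((α−1)/A)^{1/α} c^{-1}. -/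

import Mathlib

open MeasureTheory ProbabilityTheory Real Set Filter Topology
open scoped ENNReal NNReal

/-- The generalized inverse `F_μ^{-1}(t) = inf {y : F_μ(y) ≥ t}` of the cumulative
distribution function `F_μ(y) = μ((-∞, y])`. -/
noncomputable def invCDF (μ : Measure ℝ) (t : ℝ) : ℝ :=
  sInf {y : ℝ | t ≤ (μ (Iic y)).toReal}

/-- The cumulative distribution function of the symmetric exponential measure `τ`
with density `(1/2) e^{-|x|}`. -/
noncomputable def expCDF (x : ℝ) : ℝ :=
  if x < 0 then Real.exp x / 2 else 1 - Real.exp (-x) / 2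

/-- `U_μ = F_μ^{-1} ∘ F_τ`, the unique left-continuous non-decreasing map
transporting `τ` onto `μ`. -/
noncomputable def Umap (μ : Measure ℝ) (x : ℝ) : ℝ :=
  invCDF μ (expCDF x)

open scoped Classical in
/-- `Ent_μ(g) = ∫ g ln g dμ − (∫ g dμ) ln (∫ g dμ)` if `∫ g ln g dμ < ∞`, and `+∞`
otherwise (for nonnegative `g` this quantity is nonnegative, so it is recorded in `ℝ≥0∞`). -/
noncomputable def Ent (μ : Measure ℝ) (g : ℝ → ℝ) : ℝ≥0∞ :=
  if Integrable (fun x => g x * Real.log (g x)) μ then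
    ENNReal.ofReal ((∫ x, g x * Real.log (g x) ∂μ) -
      (∫ x, g x ∂μ) * Real.log (∫ x, g x ∂μ))
  else ⊤

open scoped Classical in
/-- The relative entropy `H(ν|μ) = ∫ log (dν/dμ) dν`, `+∞` if `ν` is not absolutely
continuous w.r.t. `μ` (for probability measures it is nonnegative, hence valued in `ℝ≥0∞`). -/
noncomputable def relEnt {α : Type*} [MeasurableSpace α] (ν μ : Measure α) : ℝ≥0∞ :=
  if ν ≪ μ ∧ Integrable (fun x => Real.log ((ν.rnDeriv μ x).toReal)) ν then
    ENNReal.ofReal (∫ x, Real.log ((ν.rnDeriv μ x).toReal) ∂ν)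
  else ⊤

/-- The weak (barycentric) transport cost
`T̄_θ(μ₂|μ₁) = inf_π ∫ θ(|x − ∫ y p(x,dy)|) μ₁(dx)`, the infimum running over all
couplings `π(dxdy) = p(x,dy) μ₁(dx)` of `μ₁` and `μ₂` (described by their
disintegration kernels `p`). -/
noncomputable def weakCost (θ : ℝ → ℝ) (μ₂ μ₁ : Measure ℝ) : ℝ≥0∞ :=
  ⨅ (p : Kernel ℝ ℝ) (_ : IsMarkovKernel p) (_ : μ₁.bind (fun x => p x) = μ₂),
    ∫⁻ x, ENNReal.ofReal (θ |x - ∫ y, y ∂(p x)|) ∂μ₁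

/-- `μ` satisfies `T̄⁻(θ)`: `T̄_θ(μ|ν) ≤ H(ν|μ)` for every probability measure `ν`
with finite first moment. -/
def Tminus (θ : ℝ → ℝ) (μ : Measure ℝ) : Prop :=
  ∀ ν : Measure ℝ, IsProbabilityMeasure ν → Integrable (fun x => x) ν →
    weakCost θ μ ν ≤ relEnt ν μ

/-- `μ` satisfies `T̄⁺(θ)`: `T̄_θ(ν|μ) ≤ H(ν|μ)` for every probability measure `ν`
with finite first moment. -/
def Tplus (θ : ℝ → ℝ) (μ : Measure ℝ) : Prop :=
  ∀ ν : Measure ℝ, IsProbabilityMeasure ν → Integrable (fun x => x) ν →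
    weakCost θ ν μ ≤ relEnt ν μ

/-- The inverse of an increasing cost function `θ` on `[0,∞)`:
`θ⁻¹(u) = inf {t ≥ 0 : θ(t) ≥ u}`. -/
noncomputable def cinv (θ : ℝ → ℝ) (u : ℝ) : ℝ :=
  sInf {t : ℝ | 0 ≤ t ∧ u ≤ θ t}


/-! ### Log-sum-exp -/

noncomputable def LSE {ι : Type*} [Fintype ι] (β : ℝ) (a : ι → ℝ) : ℝ :=
  Real.log (∑ i, Real.exp (β * a i)) / β

noncomputable def lwt {ι : Type*} [Fintype ι] (β : ℝ) (a : ι → ℝ) (i : ι) : ℝ :=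
  Real.exp (β * a i) / ∑ j, Real.exp (β * a j)

section LSE
variable {ι : Type*} [Fintype ι]

lemma sumexp_pos [Nonempty ι] (β : ℝ) (a : ι → ℝ) : 0 < ∑ i, Real.exp (β * a i) :=
  Finset.sum_pos (fun _ _ => Real.exp_pos _) Finset.univ_nonempty

lemma lwt_nonneg (β : ℝ) (a : ι → ℝ) (i : ι) : 0 ≤ lwt β a i :=
  div_nonneg (Real.exp_pos _).le (Finset.sum_nonneg fun _ _ => (Real.exp_pos _).le)

lemma lwt_sum [Nonempty ι] (β : ℝ) (a : ι → ℝ) : ∑ i, lwt β a i = 1 := by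
  unfold lwt
  rw [← Finset.sum_div, div_self (sumexp_pos β a).ne']

lemma le_LSE {β : ℝ} (hβ : 0 < β) (a : ι → ℝ) (i : ι) : a i ≤ LSE β a := by
  unfold LSE
  rw [le_div_iff₀ hβ, mul_comm]
  rw [Real.le_log_iff_exp_le (Finset.sum_pos (fun _ _ => Real.exp_pos _) ⟨i, Finset.mem_univ _⟩)]
  exact Finset.single_le_sum (f := fun i => Real.exp (β * a i))
    (fun _ _ => (Real.exp_pos _).le) (Finset.mem_univ i)

lemma LSE_le [Nonempty ι] {β : ℝ} (hβ : 0 < β) (a : ι → ℝ) (M : ℝ) (h : ∀ i, a i ≤ M) :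
    LSE β a ≤ M + Real.log (Fintype.card ι) / β := by
  unfold LSE
  have hc : (0:ℝ) < Fintype.card ι := by exact_mod_cast Fintype.card_pos
  have h1 : ∑ i, Real.exp (β * a i) ≤ Fintype.card ι * Real.exp (β * M) := by
    calc ∑ i, Real.exp (β * a i) ≤ ∑ i : ι, Real.exp (β * M) :=
          Finset.sum_le_sum fun i _ => Real.exp_le_exp.2 (mul_le_mul_of_nonneg_left (h i) hβ.le)
      _ = _ := by simp
  have h2 := Real.log_le_log (sumexp_pos β a) h1
  rw [Real.log_mul hc.ne' (Real.exp_pos _).ne', Real.log_exp] at h2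
  rw [div_le_iff₀ hβ, add_mul, div_mul_cancel₀ _ hβ.ne']
  linarith

lemma LSE_mono [Nonempty ι] {β : ℝ} (hβ : 0 < β) (a b : ι → ℝ) (h : ∀ i, a i ≤ b i) :
    LSE β a ≤ LSE β b := by
  unfold LSE
  refine div_le_div_of_nonneg_right (Real.log_le_log (sumexp_pos β a) ?_) hβ.le
  exact Finset.sum_le_sum fun i _ => Real.exp_le_exp.2 (mul_le_mul_of_nonneg_left (h i) hβ.le)

lemma LSE_convex [Nonempty ι] {β : ℝ} (hβ : 0 < β) (a b : ι → ℝ) (s t : ℝ) (hs : 0 ≤ s)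
    (ht : 0 ≤ t) (hst : s + t = 1) :
    LSE β (fun i => s * a i + t * b i) ≤ s * LSE β a + t * LSE β b := by
  have key : ∑ i, Real.exp (β * (s * a i + t * b i)) ≤
      Real.exp (s * Real.log (∑ i, Real.exp (β * a i)) +
        t * Real.log (∑ i, Real.exp (β * b i))) := by
    set P := ∑ i, Real.exp (β * a i) with hP
    set Q := ∑ i, Real.exp (β * b i) with hQ
    have hPp : 0 < P := sumexp_pos β a
    have hQp : 0 < Q := sumexp_pos β b
    have h1 : ∀ i, Real.exp (β * (s * a i + t * b i)) ≤
        Real.exp (s * Real.log P + t * Real.log Q) *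
          (s * (Real.exp (β * a i) / P) + t * (Real.exp (β * b i) / Q)) := by
      intro i
      have := convexOn_exp.2 (mem_univ (β * a i - Real.log P)) (mem_univ (β * b i - Real.log Q))
        hs ht hst
      simp only [smul_eq_mul, Real.exp_sub, Real.exp_log hPp, Real.exp_log hQp] at this
      calc Real.exp (β * (s * a i + t * b i))
          = Real.exp (s * Real.log P + t * Real.log Q) *
            Real.exp (s * (β * a i - Real.log P) + t * (β * b i - Real.log Q)) := by
            rw [← Real.exp_add]; congr 1; ring
        _ ≤ _ := mul_le_mul_of_nonneg_left this (Real.exp_pos _).le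
    calc _ ≤ ∑ i, Real.exp (s * Real.log P + t * Real.log Q) *
          (s * (Real.exp (β * a i) / P) + t * (Real.exp (β * b i) / Q)) :=
          Finset.sum_le_sum fun i _ => h1 i
      _ = _ := by
          rw [← Finset.mul_sum, Finset.sum_add_distrib, ← Finset.mul_sum, ← Finset.mul_sum,
            ← Finset.sum_div, ← Finset.sum_div, ← hP, ← hQ, div_self hPp.ne', div_self hQp.ne']
          rw [mul_one, mul_one, hst, mul_one]
  have h2 := Real.log_le_log (sumexp_pos β _) key
  rw [Real.log_exp] at h2
  unfold LSE
  rw [← mul_div_assoc, ← mul_div_assoc, ← add_div]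
  exact div_le_div_of_nonneg_right h2 hβ.le

lemma hasDerivAt_LSE [Nonempty ι] {β : ℝ} (hβ : 0 < β) (a : ι → ℝ → ℝ) (a' : ι → ℝ) (s : ℝ)
    (h : ∀ i, HasDerivAt (a i) (a' i) s) :
    HasDerivAt (fun s => LSE β (fun i => a i s)) (∑ i, lwt β (fun i => a i s) i * a' i) s := by
  unfold LSE
  have h1 : HasDerivAt (fun s => ∑ i, Real.exp (β * a i s))
      (∑ i, Real.exp (β * a i s) * (β * a' i)) s :=
    HasDerivAt.fun_sum fun i _ => ((h i).const_mul β).exp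
  have h2 := (h1.log (sumexp_pos β _).ne').div_const β
  have h3 : (∑ i, lwt β (fun i => a i s) i * a' i) =
      (∑ i, Real.exp (β * a i s) * (β * a' i)) / (∑ i, Real.exp (β * a i s)) / β := by
    unfold lwt
    rw [Finset.sum_div, Finset.sum_div]
    refine Finset.sum_congr rfl fun i _ => ?_
    field_simp
  rw [h3]; exact h2

lemma contDiff_LSE [Nonempty ι] (β : ℝ) (a : ι → ℝ → ℝ) (h : ∀ i, ContDiff ℝ (⊤ : ℕ∞) (a i)) :
    ContDiff ℝ (⊤ : ℕ∞) (fun s => LSE β (fun i => a i s)) := by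
  unfold LSE
  refine ContDiff.div_const (ContDiff.log (ContDiff.sum fun i _ => ?_)
    (fun x => (sumexp_pos β _).ne')) β
  exact (contDiff_const.mul (h i)).exp

lemma lwt_continuous {X : Type*} [TopologicalSpace X] [Nonempty ι] (β : ℝ) (a : ι → X → ℝ)
    (h : ∀ i, Continuous (a i)) (i : ι) : Continuous (fun s => lwt β (fun i => a i s) i) := by
  unfold lwt
  refine Continuous.div ?_ ?_ (fun x => (sumexp_pos β _).ne')
  · exact Real.continuous_exp.comp (continuous_const.mul (h i))
  · exact continuous_finsetSum _ fun i _ => Real.continuous_exp.comp (continuous_const.mul (h i))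

lemma wavg_abs_le {p v : ι → ℝ} {V : ℝ} (hp : ∀ i, 0 ≤ p i) (hp1 : ∑ i, p i = 1)
    (hv : ∀ i, |v i| ≤ V) : |∑ i, p i * v i| ≤ V := by
  calc |∑ i, p i * v i| ≤ ∑ i, |p i * v i| := Finset.abs_sum_le_sum_abs _ _
    _ ≤ ∑ i, p i * V := Finset.sum_le_sum fun i _ => by
        rw [abs_mul, abs_of_nonneg (hp i)]; exact mul_le_mul_of_nonneg_left (hv i) (hp i)
    _ = V := by rw [← Finset.sum_mul, hp1, one_mul]

end LSE

/-! ### Integrability helpers -/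

lemma integrable_of_exp_bound {μ : Measure ℝ}
    (hexp : ∀ s > (0:ℝ), Integrable (fun x => Real.exp (s * |x|)) μ)
    {f : ℝ → ℝ} (hf : AEStronglyMeasurable f μ) (C s : ℝ) (hs : 0 < s)
    (h : ∀ x, |f x| ≤ C * Real.exp (s * |x|)) : Integrable f μ :=
  ((hexp s hs).const_mul C).mono' hf (Eventually.of_forall fun x => by
    simpa [Real.norm_eq_abs] using h x)

lemma linear_le_exp {C K x : ℝ} (hC : 0 ≤ C) (hK : 0 ≤ K) :
    C + K * |x| ≤ (C + K) * Real.exp (1 * |x|) := by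
  have h1 : 1 ≤ Real.exp (1 * |x|) := Real.one_le_exp (by positivity)
  have h2 : |x| ≤ Real.exp (1 * |x|) := by
    have := Real.add_one_le_exp (1 * |x|); linarith
  nlinarith [abs_nonneg x]

lemma linexp_bound {C K D M x y z : ℝ} (hC : 0 ≤ C) (hK : 0 ≤ K)
    (hz : |z| ≤ C + K * |x|) (hy : y ≤ D + M * |x|) :
    |z * Real.exp y| ≤ ((C + K) * Real.exp D) * Real.exp ((1 + M) * |x|) := by
  rw [abs_mul, Real.abs_exp]
  calc |z| * Real.exp y ≤ ((C + K) * Real.exp (1 * |x|)) * Real.exp (D + M * |x|) :=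
        mul_le_mul (hz.trans (linear_le_exp hC hK)) (Real.exp_le_exp.2 hy) (Real.exp_pos _).le
          (by positivity)
    _ = _ := by
        rw [Real.exp_add, add_mul 1 M, Real.exp_add]; ring

/-! ### Real form of the log-Sobolev inequality -/

lemma lsi_real {H : ℝ → ℝ} (hHnn : ∀ x, 0 ≤ H x) (hHcont : Continuous H)
    {μ : Measure ℝ} [IsProbabilityMeasure μ]
    (hexp : ∀ s > (0:ℝ), Integrable (fun x => Real.exp (s * |x|)) μ)
    {c : ℝ}
    (hLSI : ∀ φ : ℝ → ℝ, ContDiff ℝ (⊤ : ℕ∞) φ → ConvexOn ℝ Set.univ φ →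
      (∃ K : ℝ≥0, LipschitzWith K φ) →
      Ent μ (fun x => Real.exp (φ x)) ≤
        ∫⁻ x, ENNReal.ofReal (H (c * deriv φ x) * Real.exp (φ x)) ∂μ)
    (φ : ℝ → ℝ) (h1 : ContDiff ℝ (⊤ : ℕ∞) φ) (h2 : ConvexOn ℝ Set.univ φ)
    (K : ℝ≥0) (h3 : LipschitzWith K φ) :
    Integrable (fun x => H (c * deriv φ x) * Real.exp (φ x)) μ ∧
    (∫ x, φ x * Real.exp (φ x) ∂μ) - (∫ x, Real.exp (φ x) ∂μ) * Real.log (∫ x, Real.exp (φ x) ∂μ)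
      ≤ ∫ x, H (c * deriv φ x) * Real.exp (φ x) ∂μ := by
  have hb : ∀ x, |φ x| ≤ |φ 0| + K * |x| := by
    intro x
    have := h3.dist_le_mul x 0
    rw [Real.dist_eq, Real.dist_eq, sub_zero] at this
    have h4 := abs_sub_abs_le_abs_sub (φ x) (φ 0)
    linarith
  have hb' : ∀ x, φ x ≤ |φ 0| + K * |x| := fun x => (le_abs_self _).trans (hb x)
  have hcont : Continuous φ := h1.continuous
  have hdc : Continuous (deriv φ) := h1.continuous_deriv (by simp)
  have hdb : ∀ x, |deriv φ x| ≤ K := fun x => by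
    simpa [Real.norm_eq_abs] using norm_deriv_le_of_lipschitz h3 (x₀ := x)
  obtain ⟨B, hB⟩ := (isCompact_Icc (a := -(|c| * K)) (b := |c| * K)).exists_bound_of_continuousOn
    hHcont.continuousOn
  have hHb : ∀ x, |H (c * deriv φ x)| ≤ B := fun x => by
    have := hB (c * deriv φ x) (by
      rw [Set.mem_Icc, ← abs_le, abs_mul]; exact mul_le_mul_of_nonneg_left (hdb x) (abs_nonneg c))
    simpa using this
  have i1 : Integrable (fun x => φ x * Real.exp (φ x)) μ :=
    integrable_of_exp_bound hexp (by fun_prop) _ (1 + K) (by positivity)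
      fun x => linexp_bound (abs_nonneg (φ 0)) K.2 (hb x) (hb' x)
  have hBnn : 0 ≤ B := (abs_nonneg _).trans (hHb 0)
  have i2 : Integrable (fun x => H (c * deriv φ x) * Real.exp (φ x)) μ :=
    integrable_of_exp_bound hexp (by fun_prop) _ (1 + K) (by positivity)
      fun x => linexp_bound (C := B) (K := 0) hBnn le_rfl (by simpa using hHb x) (hb' x)
  refine ⟨i2, ?_⟩
  have := hLSI φ h1 h2 ⟨K, h3⟩
  unfold Ent at this
  simp only [Real.log_exp] at this
  have i1' : Integrable (fun x => Real.exp (φ x) * Real.log (Real.exp (φ x))) μ := by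
    simpa [mul_comm] using i1
  rw [if_pos i1', ← ofReal_integral_eq_lintegral_ofReal i2 (Eventually.of_forall fun x =>
    mul_nonneg (hHnn _) (Real.exp_pos _).le), ENNReal.ofReal_le_ofReal_iff (integral_nonneg fun x =>
    mul_nonneg (hHnn _) (Real.exp_pos _).le)] at this
  simpa [mul_comm] using this

/-! ### The Hamilton–Jacobi argument -/

section HJ
variable {ι : Type*} [Fintype ι] [Nonempty ι]

lemma antitone_F {μ : Measure ℝ} [IsProbabilityMeasure μ]
    (hexp : ∀ s > (0:ℝ), Integrable (fun x => Real.exp (s * |x|)) μ)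
    {α : ℝ} (hα₁ : 1 < α) (hα₂ : α ≤ 2) {L : ℝ → ℝ} (hLconv : ConvexOn ℝ univ L)
    (hLnn : ∀ x, 0 ≤ L x) {Hc : ℝ → ℝ}
    (hHL : ∀ k ∈ Ioc (0:ℝ) 1, ∀ x, Hc (k * x) ≤ (α - 1) * k ^ α * L x)
    (hLSI : ∀ (φ : ℝ → ℝ), ContDiff ℝ (⊤ : ℕ∞) φ → ConvexOn ℝ Set.univ φ →
      ∀ (K : ℝ≥0), LipschitzWith K φ →
      Integrable (fun x => Hc (deriv φ x) * Real.exp (φ x)) μ ∧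
      (∫ x, φ x * Real.exp (φ x) ∂μ) -
        (∫ x, Real.exp (φ x) ∂μ) * Real.log (∫ x, Real.exp (φ x) ∂μ)
      ≤ ∫ x, Hc (deriv φ x) * Real.exp (φ x) ∂μ)
    (u d : ι → ℝ) {β : ℝ} (hβ : 0 < β) :
    AntitoneOn (fun k : ℝ => Real.log (∫ x, Real.exp (k *
      LSE β (fun i => u i * x + d i - k ^ (α - 1) * L (u i))) ∂μ) / k) (Ioc 0 1) := by
  -- abbreviations
  set a : ℝ → ℝ → ι → ℝ := fun k x i => u i * x + d i - k ^ (α - 1) * L (u i) with ha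
  set ψ : ℝ → ℝ → ℝ := fun k x => LSE β (a k x) with hψ
  set E : ℝ → ℝ → ℝ := fun k x => ∑ i, lwt β (a k x) i * L (u i) with hE
  obtain ⟨U, hU⟩ : ∃ U, ∀ i, |u i| ≤ U :=
    ⟨∑ i, |u i|, fun i => Finset.single_le_sum (f := fun i => |u i|)
      (fun _ _ => abs_nonneg _) (Finset.mem_univ i)⟩
  obtain ⟨D, hD⟩ : ∃ D, ∀ i, |d i| ≤ D :=
    ⟨∑ i, |d i|, fun i => Finset.single_le_sum (f := fun i => |d i|)
      (fun _ _ => abs_nonneg _) (Finset.mem_univ i)⟩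
  obtain ⟨V, hV⟩ : ∃ V, ∀ i, |L (u i)| ≤ V :=
    ⟨∑ i, |L (u i)|, fun i => Finset.single_le_sum (f := fun i => |L (u i)|)
      (fun _ _ => abs_nonneg _) (Finset.mem_univ i)⟩
  have i0 : ι := Classical.arbitrary ι
  have hU0 : 0 ≤ U := (abs_nonneg _).trans (hU i0)
  have hD0 : 0 ≤ D := (abs_nonneg _).trans (hD i0)
  have hV0 : 0 ≤ V := (abs_nonneg _).trans (hV i0)
  have hcard : 0 ≤ Real.log (Fintype.card ι) / β :=
    div_nonneg (Real.log_nonneg (by exact_mod_cast Fintype.card_pos)) hβ.le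
  set C := D + 2 * V + Real.log (Fintype.card ι) / β with hC
  have hC0 : 0 ≤ C := by positivity
  have hpow : ∀ k ∈ Ioo (0:ℝ) 2, 0 ≤ k ^ (α - 1) ∧ k ^ (α - 1) ≤ 2 := by
    intro k hk
    refine ⟨Real.rpow_nonneg hk.1.le _, ?_⟩
    calc k ^ (α - 1) ≤ 2 ^ (α - 1) := Real.rpow_le_rpow hk.1.le hk.2.le (by linarith)
      _ ≤ 2 ^ (1:ℝ) := Real.rpow_le_rpow_of_exponent_le (by norm_num) (by linarith)
      _ = 2 := Real.rpow_one 2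
  have hab : ∀ k ∈ Ioo (0:ℝ) 2, ∀ x i, |a k x i| ≤ D + 2 * V + U * |x| := by
    intro k hk x i
    have h1 : |u i * x| ≤ U * |x| := by
      rw [abs_mul]; exact mul_le_mul_of_nonneg_right (hU i) (abs_nonneg x)
    have h2 : |k ^ (α - 1) * L (u i)| ≤ 2 * V := by
      rw [abs_mul, abs_of_nonneg (hpow k hk).1]
      exact mul_le_mul (hpow k hk).2 (hV i) (abs_nonneg _) (by norm_num)
    have h3 := hD i
    rw [abs_le] at *
    simp only [ha]
    constructor <;> linarith [h1.1, h1.2, h2.1, h2.2, h3.1, h3.2]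
  have hψb : ∀ k ∈ Ioo (0:ℝ) 2, ∀ x, |ψ k x| ≤ C + U * |x| := by
    intro k hk x
    have h1 := LSE_le hβ (a k x) (D + 2 * V + U * |x|) fun i => (abs_le.1 (hab k hk x i)).2
    have h2 := le_LSE hβ (a k x) i0
    have h3 := (abs_le.1 (hab k hk x i0)).1
    simp only [hψ]
    rw [abs_le]; constructor <;> linarith
  have hEb : ∀ k x, |E k x| ≤ V := fun k x =>
    wavg_abs_le (lwt_nonneg β _) (lwt_sum β _) hV
  have hac : ∀ k i, Continuous (fun x => a k x i) := fun k i => by simp only [ha]; fun_prop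
  have hψc : ∀ k, ContDiff ℝ (⊤ : ℕ∞) (ψ k) := fun k =>
    contDiff_LSE β (fun i x => a k x i) fun i => by simp only [ha]; fun_prop
  have hEc : ∀ k, Continuous (E k) := fun k =>
    continuous_finsetSum _ fun i _ =>
      (lwt_continuous β (fun i x => a k x i) (hac k) i).mul continuous_const
  have hψx : ∀ k x, HasDerivAt (ψ k) (∑ i, lwt β (a k x) i * u i) x := fun k x =>
    hasDerivAt_LSE hβ (fun i x => a k x i) u x fun i => by
      simpa [ha] using (((hasDerivAt_id x).const_mul (u i)).add_const (d i)).sub_const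
        (k ^ (α - 1) * L (u i))
  have hψk : ∀ k ∈ Ioo (0:ℝ) 2, ∀ x,
      HasDerivAt (fun k => ψ k x) (-((α - 1) * k ^ (α - 2) * E k x)) k := by
    intro k hk x
    have h1 := hasDerivAt_LSE hβ (fun i k => a k x i) (fun i => -((α - 1) * k ^ (α - 2) * L (u i)))
      k fun i => by
        have := ((Real.hasDerivAt_rpow_const (x := k) (p := α - 1) (Or.inl hk.1.ne')).mul_const
          (L (u i))).const_sub (u i * x + d i)
        rw [show α - 1 - 1 = α - 2 by ring] at this
        exact this
    have h2 : (∑ i, lwt β (fun i => a k x i) i * -((α - 1) * k ^ (α - 2) * L (u i))) =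
        -((α - 1) * k ^ (α - 2) * E k x) := by
      simp only [hE, Finset.mul_sum]
      rw [← Finset.sum_neg_distrib]
      exact Finset.sum_congr rfl fun i _ => by ring
    rw [h2] at h1
    exact h1
  have hkp : ∀ k ∈ Ioo (0:ℝ) 2, k * k ^ (α - 2) = k ^ (α - 1) := by
    intro k hk
    rw [show α - 1 = 1 + (α - 2) by ring, Real.rpow_add hk.1, Real.rpow_one]
  set Z : ℝ → ℝ := fun k => ∫ x, Real.exp (k * ψ k x) ∂μ with hZ
  set G' : ℝ → ℝ → ℝ := fun k x => (ψ k x - (α - 1) * k ^ (α - 1) * E k x) with hG'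
  have hGk : ∀ k ∈ Ioo (0:ℝ) 2, ∀ x, HasDerivAt (fun k => Real.exp (k * ψ k x))
      (G' k x * Real.exp (k * ψ k x)) k := by
    intro k hk x
    have h1 := ((hasDerivAt_id k).mul (hψk k hk x)).exp
    refine h1.congr_deriv ?_
    simp only [id, Pi.mul_apply, hG']
    rw [← hkp k hk]; ring
  have hGb : ∀ k ∈ Ioo (0:ℝ) 2, ∀ x, |G' k x| ≤ (C + 2 * V) + U * |x| := by
    intro k hk x
    have h1 : |(α - 1) * k ^ (α - 1) * E k x| ≤ 2 * V := by
      rw [abs_mul, abs_of_nonneg (mul_nonneg (by linarith) (hpow k hk).1)]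
      refine mul_le_mul ?_ (hEb k x) (abs_nonneg _) (by norm_num)
      nlinarith [(hpow k hk).1, (hpow k hk).2]
    have h2 := hψb k hk x
    simp only [hG']
    rw [abs_le] at *
    constructor <;> linarith [h1.1, h1.2, h2.1, h2.2]
  have hkψ : ∀ k ∈ Ioo (0:ℝ) 2, ∀ x, k * ψ k x ≤ 2 * C + 2 * U * |x| := by
    intro k hk x
    have h2 := hψb k hk x
    have h3 : 0 ≤ C + U * |x| := by positivity
    calc k * ψ k x ≤ k * (C + U * |x|) :=
          mul_le_mul_of_nonneg_left ((le_abs_self _).trans h2) hk.1.le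
      _ ≤ 2 * (C + U * |x|) := mul_le_mul_of_nonneg_right hk.2.le h3
      _ = _ := by ring
  have hGbound : ∀ k ∈ Ioo (0:ℝ) 2, ∀ x, |G' k x * Real.exp (k * ψ k x)| ≤
      ((C + 2 * V + U) * Real.exp (2 * C)) * Real.exp ((1 + 2 * U) * |x|) := fun k hk x =>
    linexp_bound (by positivity) hU0 (hGb k hk x) (hkψ k hk x)
  have hψcont : ∀ k, Continuous (ψ k) := fun k => (hψc k).continuous
  have hexpint : ∀ k ∈ Ioo (0:ℝ) 2, Integrable (fun x => Real.exp (k * ψ k x)) μ := by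
    intro k hk
    refine integrable_of_exp_bound hexp
      (Continuous.aestronglyMeasurable (by have := hψcont k; fun_prop))
      ((1 + 0) * Real.exp (2 * C)) (1 + 2 * U) (by positivity) fun x => ?_
    have := linexp_bound (z := 1) (C := 1) (K := 0) zero_le_one le_rfl (by simp) (hkψ k hk x)
    simpa using this
  have hEint : ∀ k ∈ Ioo (0:ℝ) 2, Integrable (fun x => E k x * Real.exp (k * ψ k x)) μ := by
    intro k hk
    refine integrable_of_exp_bound hexp
      (Continuous.aestronglyMeasurable (by have := hψcont k; have := hEc k; fun_prop)) _ (1 + 2 * U)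
      (by positivity)
      fun x => linexp_bound (C := V) (K := 0) hV0 le_rfl (by simpa using hEb k x) (hkψ k hk x)
  have hψint : ∀ k ∈ Ioo (0:ℝ) 2, Integrable (fun x => ψ k x * Real.exp (k * ψ k x)) μ := by
    intro k hk
    refine integrable_of_exp_bound hexp
      (Continuous.aestronglyMeasurable (by have := hψcont k; fun_prop)) _ (1 + 2 * U)
      (by positivity)
      fun x => linexp_bound hC0 hU0 (hψb k hk x) (hkψ k hk x)
  have hZpos : ∀ k ∈ Ioo (0:ℝ) 2, 0 < Z k := fun k hk => integral_exp_pos (hexpint k hk)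
  have hZd : ∀ k ∈ Ioo (0:ℝ) 2, HasDerivAt Z (∫ x, G' k x * Real.exp (k * ψ k x) ∂μ) k := by
    intro k hk
    refine (hasDerivAt_integral_of_dominated_loc_of_deriv_le (s := Ioo (0:ℝ) 2)
      (F' := fun k x => G' k x * Real.exp (k * ψ k x))
      (bound := fun x => ((C + 2 * V + U) * Real.exp (2 * C)) * Real.exp ((1 + 2 * U) * |x|))
      (Ioo_mem_nhds hk.1 hk.2) ?_ (hexpint k hk) ?_ ?_ ?_ ?_).2
    · exact Eventually.of_forall fun k => Continuous.aestronglyMeasurable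
        (by have := hψcont k; fun_prop)
    · exact Continuous.aestronglyMeasurable
        (by have := hψcont k; have := hEc k; simp only [hG']; fun_prop)
    · exact Eventually.of_forall fun x k hk => by simpa [Real.norm_eq_abs] using hGbound k hk x
    · exact (hexp _ (by positivity)).const_mul _
    · exact Eventually.of_forall fun x k hk => hGk k hk x
  have hFd : ∀ k ∈ Ioo (0:ℝ) 2, HasDerivAt (fun k => Real.log (Z k) / k)
      ((((∫ x, G' k x * Real.exp (k * ψ k x) ∂μ) / Z k) * k - Real.log (Z k) * 1) / k ^ 2) k :=
    fun k hk => ((hZd k hk).log (hZpos k hk).ne').div (hasDerivAt_id k) hk.1.ne'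
  have hsub : ∀ k ∈ Ioc (0:ℝ) 1, k ∈ Ioo (0:ℝ) 2 := fun k hk => ⟨hk.1, by linarith [hk.2]⟩
  have hconvψ : ∀ k, ConvexOn ℝ univ (ψ k) := by
    intro k
    refine ⟨convex_univ, fun x _ y _ s t hs ht hst => ?_⟩
    have := LSE_convex hβ (a k x) (a k y) s t hs ht hst
    refine le_trans (le_of_eq ?_) this
    simp only [hψ, ha, smul_eq_mul]
    congr 1
    funext i
    have : t = 1 - s := by linarith
    subst this; ring
  have hmain : ∀ k ∈ Ioc (0:ℝ) 1,
      ((((∫ x, G' k x * Real.exp (k * ψ k x) ∂μ) / Z k) * k - Real.log (Z k) * 1) / k ^ 2) ≤ 0 := by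
    intro k hk
    have hk2 := hsub k hk
    refine div_nonpos_of_nonpos_of_nonneg ?_ (sq_nonneg k)
    have hlip : LipschitzWith (U.toNNReal) (fun x => k * ψ k x) := by
      refine lipschitzWith_of_nnnorm_deriv_le
        (fun x => ((hψx k x).const_mul k).differentiableAt) fun x => ?_
      rw [((hψx k x).const_mul k).deriv, ← NNReal.coe_le_coe, Real.coe_toNNReal _ hU0, coe_nnnorm,
        Real.norm_eq_abs, abs_mul, abs_of_pos hk.1]
      have := wavg_abs_le (lwt_nonneg β (a k x)) (lwt_sum β _) hU
      calc _ ≤ 1 * U := mul_le_mul hk.2 this (abs_nonneg _) zero_le_one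
        _ = U := one_mul U
    have hcv : ConvexOn ℝ univ (fun x => k * ψ k x) := by
      simpa [smul_eq_mul] using (hconvψ k).smul hk.1.le
    obtain ⟨hi, hl⟩ := hLSI (fun x => k * ψ k x) (contDiff_const.mul (hψc k)) hcv _ hlip
    have hj : ∀ x, Hc (deriv (fun x => k * ψ k x) x) * Real.exp (k * ψ k x) ≤
        ((α - 1) * k ^ α) * (E k x * Real.exp (k * ψ k x)) := by
      intro x
      rw [((hψx k x).const_mul k).deriv, ← mul_assoc]
      refine mul_le_mul_of_nonneg_right ?_ (Real.exp_pos _).le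
      refine (hHL k hk _).trans ?_
      refine mul_le_mul_of_nonneg_left ?_ (mul_nonneg (by linarith) (Real.rpow_nonneg hk.1.le _))
      have := hLconv.map_sum_le (t := Finset.univ) (w := lwt β (a k x)) (p := u)
        (fun i _ => lwt_nonneg β _ i) (lwt_sum β _) (fun i _ => mem_univ _)
      simpa [smul_eq_mul, hE] using this
    have hj2 := integral_mono hi ((hEint k hk2).const_mul ((α - 1) * k ^ α)) hj
    rw [integral_const_mul] at hj2
    have hsplit : ∫ x, G' k x * Real.exp (k * ψ k x) ∂μ =
        (∫ x, ψ k x * Real.exp (k * ψ k x) ∂μ) -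
          (α - 1) * k ^ (α - 1) * ∫ x, E k x * Real.exp (k * ψ k x) ∂μ := by
      rw [← integral_const_mul, ← integral_sub (hψint k hk2) ((hEint k hk2).const_mul _)]
      refine integral_congr_ae (Eventually.of_forall fun x => ?_)
      simp only [hG']; ring
    have hq : ∫ x, k * ψ k x * Real.exp (k * ψ k x) ∂μ =
        k * ∫ x, ψ k x * Real.exp (k * ψ k x) ∂μ := by
      rw [← integral_const_mul]
      exact integral_congr_ae (Eventually.of_forall fun x => by ring)
    rw [hq] at hl
    have hkα : k * k ^ (α - 1) = k ^ α := by
      rw [show α = 1 + (α - 1) by ring, Real.rpow_add hk.1, Real.rpow_one]; ring_nf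
    have hZp := hZpos k hk2
    rw [hsplit, mul_one, sub_nonpos, div_mul_eq_mul_div, div_le_iff₀ hZp]
    have hl' := hl.trans hj2
    change k * (∫ x, ψ k x * Real.exp (k * ψ k x) ∂μ) - Z k * Real.log (Z k) ≤ _ at hl'
    rw [← hkα] at hl'
    linarith
  refine antitoneOn_of_deriv_nonpos (convex_Ioc 0 1) ?_ ?_ ?_
  · exact fun k hk => (hFd k (hsub k hk)).continuousAt.continuousWithinAt
  · exact fun k hk => (hFd k (hsub k (interior_subset hk))).differentiableAt.differentiableWithinAt
  · intro k hk
    have hk' := interior_subset hk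
    have := (hFd k (hsub k hk')).deriv
    exact this.le.trans (hmain k hk')

end HJ

lemma hj_sel {ι : Type*} [Fintype ι] [Nonempty ι] {μ : Measure ℝ} [IsProbabilityMeasure μ]
    (hexp : ∀ s > (0:ℝ), Integrable (fun x => Real.exp (s * |x|)) μ)
    {α : ℝ} (hα₁ : 1 < α) (hα₂ : α ≤ 2) {L : ℝ → ℝ} (hLconv : ConvexOn ℝ univ L)
    (hLnn : ∀ x, 0 ≤ L x) {Hc : ℝ → ℝ}
    (hHL : ∀ k ∈ Ioc (0:ℝ) 1, ∀ x, Hc (k * x) ≤ (α - 1) * k ^ α * L x)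
    (hLSI : ∀ (φ : ℝ → ℝ), ContDiff ℝ (⊤ : ℕ∞) φ → ConvexOn ℝ Set.univ φ →
      ∀ (K : ℝ≥0), LipschitzWith K φ →
      Integrable (fun x => Hc (deriv φ x) * Real.exp (φ x)) μ ∧
      (∫ x, φ x * Real.exp (φ x) ∂μ) -
        (∫ x, Real.exp (φ x) ∂μ) * Real.log (∫ x, Real.exp (φ x) ∂μ)
      ≤ ∫ x, Hc (deriv φ x) * Real.exp (φ x) ∂μ)
    (u d : ι → ℝ) (ψ Φ : ℝ → ℝ) (hψm : Measurable ψ)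
    (hψ : ∀ x, ∃ i, ψ x ≤ u i * x + d i - L (u i))
    (hΦi : Integrable Φ μ) (hΦ : ∀ x i, u i * x + d i ≤ Φ x) :
    Integrable (fun x => Real.exp (ψ x)) μ ∧
      Real.log (∫ x, Real.exp (ψ x) ∂μ) ≤ ∫ x, Φ x ∂μ := by
  obtain ⟨U, hU⟩ : ∃ U, ∀ i, |u i| ≤ U :=
    ⟨∑ i, |u i|, fun i => Finset.single_le_sum (f := fun i => |u i|)
      (fun _ _ => abs_nonneg _) (Finset.mem_univ i)⟩
  obtain ⟨D, hD⟩ : ∃ D, ∀ i, |d i| ≤ D :=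
    ⟨∑ i, |d i|, fun i => Finset.single_le_sum (f := fun i => |d i|)
      (fun _ _ => abs_nonneg _) (Finset.mem_univ i)⟩
  have i0 : ι := Classical.arbitrary ι
  have hU0 : 0 ≤ U := (abs_nonneg _).trans (hU i0)
  have hD0 : 0 ≤ D := (abs_nonneg _).trans (hD i0)
  have hab : ∀ x i, |u i * x + d i| ≤ D + U * |x| := by
    intro x i
    have h1 : |u i * x| ≤ U * |x| := by
      rw [abs_mul]; exact mul_le_mul_of_nonneg_right (hU i) (abs_nonneg x)
    have := abs_add_le (u i * x) (d i)
    linarith [hD i]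
  have hψint : Integrable (fun x => Real.exp (ψ x)) μ := by
    refine integrable_of_exp_bound hexp (by fun_prop) (1 * Real.exp D) (U + 1) (by positivity)
      fun x => ?_
    obtain ⟨i, hi⟩ := hψ x
    rw [Real.abs_exp, one_mul, ← Real.exp_add, Real.exp_le_exp]
    have := (abs_le.1 (hab x i)).2
    nlinarith [hLnn (u i), abs_nonneg x]
  refine ⟨hψint, ?_⟩
  set N : ℝ := Real.log (Fintype.card ι) with hN
  have hN0 : 0 ≤ N := Real.log_nonneg (by exact_mod_cast Fintype.card_pos)
  have key : ∀ β : ℝ, 0 < β → Real.log (∫ x, Real.exp (ψ x) ∂μ) ≤ (∫ x, Φ x ∂μ) + N / β := by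
    intro β hβ
    have hanti := antitone_F hexp hα₁ hα₂ hLconv hLnn hHL hLSI u d hβ
    set ψ0 : ℝ → ℝ := fun x => LSE β (fun i => u i * x + d i) with hψ0
    have hcont : ∀ k : ℝ, Continuous
        (fun x => LSE β (fun i => u i * x + d i - k ^ (α - 1) * L (u i))) := fun k =>
      (contDiff_LSE β (fun i x => u i * x + d i - k ^ (α - 1) * L (u i))
        fun i => by fun_prop).continuous
    have hcont0 : Continuous ψ0 :=
      (contDiff_LSE β (fun i x => u i * x + d i) fun i => by fun_prop).continuous
    have hb0 : ∀ x, |ψ0 x| ≤ (D + N / β) + U * |x| := by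
      intro x
      have h1 := LSE_le hβ (fun i => u i * x + d i) (D + U * |x|) fun i => (abs_le.1 (hab x i)).2
      have h2 := le_LSE hβ (fun i => u i * x + d i) i0
      have h3 := (abs_le.1 (hab x i0)).1
      have h4 : 0 ≤ N / β := by positivity
      simp only [hψ0]
      rw [abs_le]; constructor <;> linarith
    have hle0 : ∀ k : ℝ, 0 < k → ∀ x,
        LSE β (fun i => u i * x + d i - k ^ (α - 1) * L (u i)) ≤ ψ0 x := by
      intro k hk x
      refine LSE_mono hβ _ _ fun i => ?_
      have := mul_nonneg (Real.rpow_nonneg hk.le (α - 1)) (hLnn (u i))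
      linarith
    have hexp0 : ∀ k : ℝ, Integrable (fun x => Real.exp (k * ψ0 x)) μ := by
      intro k
      refine integrable_of_exp_bound hexp (by fun_prop) (Real.exp (|k| * (D + N / β)))
        (|k| * U + 1) (by positivity) fun x => ?_
      rw [Real.abs_exp, ← Real.exp_add, Real.exp_le_exp]
      have h1 : k * ψ0 x ≤ |k| * ((D + N / β) + U * |x|) := by
        refine (le_abs_self _).trans ?_
        rw [abs_mul]; exact mul_le_mul_of_nonneg_left (hb0 x) (abs_nonneg k)
      nlinarith [abs_nonneg x]
    have hint0 : Integrable ψ0 μ :=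
      integrable_of_exp_bound hexp (by fun_prop) _ 1 one_pos
        fun x => (hb0 x).trans (linear_le_exp (by positivity) hU0)
    have hset : integrableExpSet ψ0 μ = univ := by
      ext k; simpa [integrableExpSet] using hexp0 k
    have h0mem : (0:ℝ) ∈ interior (integrableExpSet ψ0 μ) := by rw [hset]; simp
    have hder : HasDerivAt (cgf ψ0 μ) (∫ x, ψ0 x ∂μ) 0 := by
      have h1 := (analyticAt_cgf h0mem).differentiableAt.hasDerivAt
      rw [deriv_cgf_zero h0mem] at h1
      simpa using h1
    have htend : Tendsto (fun k => cgf ψ0 μ k / k) (𝓝[>] 0) (𝓝 (∫ x, ψ0 x ∂μ)) := by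
      have h1 := hder.tendsto_slope.mono_left (nhdsWithin_mono (0:ℝ) (s := Ioi 0)
        (fun x hx => by simpa using (ne_of_gt hx)))
      refine h1.congr fun k => ?_
      rw [slope_def_field, cgf_zero, sub_zero, sub_zero]
    have hexpk : ∀ k : ℝ, 0 < k → Integrable (fun x => Real.exp (k *
        LSE β (fun i => u i * x + d i - k ^ (α - 1) * L (u i)))) μ := by
      intro k hk
      refine (hexp0 k).mono'
        (Real.continuous_exp.comp (continuous_const.mul (hcont k))).aestronglyMeasurable (Eventually.of_forall fun x => ?_)
      rw [Real.norm_eq_abs, Real.abs_exp, Real.exp_le_exp]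
      exact mul_le_mul_of_nonneg_left (hle0 k hk x) hk.le
    have hF1 : Real.log (∫ x, Real.exp (ψ x) ∂μ) ≤ ∫ x, ψ0 x ∂μ := by
      refine ge_of_tendsto htend ?_
      filter_upwards [Ioc_mem_nhdsGT (zero_lt_one' ℝ)] with k hk
      have h1 := hanti hk (right_mem_Ioc.2 zero_lt_one) hk.2
      simp only [div_one, one_mul, Real.one_rpow] at h1
      have h2 : Real.log (∫ x, Real.exp (ψ x) ∂μ) ≤ Real.log (∫ x, Real.exp
          (LSE β (fun i => u i * x + d i - L (u i))) ∂μ) := by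
        refine Real.log_le_log (integral_exp_pos hψint) (integral_mono hψint ?_ fun x => ?_)
        · simpa using hexpk 1 one_pos
        · obtain ⟨i, hi⟩ := hψ x
          exact Real.exp_le_exp.2 (hi.trans (le_LSE hβ (fun i => u i * x + d i - L (u i)) i))
      refine h2.trans (h1.trans ?_)
      refine div_le_div_of_nonneg_right ?_ hk.1.le
      unfold cgf mgf
      refine Real.log_le_log (integral_exp_pos (hexpk k hk.1))
        (integral_mono (hexpk k hk.1) (hexp0 k) fun x => ?_)
      exact Real.exp_le_exp.2 (mul_le_mul_of_nonneg_left (hle0 k hk.1 x) hk.1.le)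
    refine hF1.trans ?_
    calc ∫ x, ψ0 x ∂μ ≤ ∫ x, (Φ x + N / β) ∂μ :=
          integral_mono hint0 (hΦi.add (integrable_const _)) fun x =>
            LSE_le hβ _ _ fun i => hΦ x i
      _ = _ := by rw [integral_add hΦi (integrable_const _)]; simp
  have ht : Tendsto (fun β : ℝ => (∫ x, Φ x ∂μ) + N / β) atTop (𝓝 ((∫ x, Φ x ∂μ) + 0)) :=
    tendsto_const_nhds.add (tendsto_const_nhds.div_atTop tendsto_id)
  rw [add_zero] at ht
  exact ge_of_tendsto ht (by filter_upwards [eventually_gt_atTop 0] with β hβ using key β hβ)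

/-- The Gibbs variational inequality. -/
lemma gibbs {ν μ : Measure ℝ} [IsProbabilityMeasure ν] [IsProbabilityMeasure μ] (hac : ν ≪ μ)
    (hllr : Integrable (fun x => Real.log ((ν.rnDeriv μ x).toReal)) ν) {ψ : ℝ → ℝ}
    (h1 : Integrable ψ ν) (h2 : Integrable (fun x => Real.exp (ψ x)) μ) :
    ∫ x, ψ x ∂ν ≤ (∫ x, Real.log ((ν.rnDeriv μ x).toReal) ∂ν) +
      Real.log (∫ x, Real.exp (ψ x) ∂μ) := by
  have e1 := integral_llr_tilted_right hac h1 h2 (show Integrable (llr ν μ) ν from hllr)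
  have e2 := integrable_llr_tilted_right hac h1 (show Integrable (llr ν μ) ν from hllr) h2
  have : IsProbabilityMeasure (μ.tilted ψ) := isProbabilityMeasure_tilted h2
  have e3 := InformationTheory.integral_llr_add_sub_measure_univ_nonneg
    (hac.trans (absolutelyContinuous_tilted h2)) e2
  simp only [probReal_univ] at e3
  have e4 : ∫ x, llr ν μ x ∂ν = ∫ x, Real.log ((ν.rnDeriv μ x).toReal) ∂ν := rfl
  linarith

/-! ### Conjugates -/

lemma conj_convex {L θ : ℝ → ℝ} (h : ∀ x, IsLUB (Set.range fun u => x * u - L u) (θ x)) :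
    ConvexOn ℝ univ θ := by
  refine ⟨convex_univ, fun x _ y _ s t hs ht hst => ?_⟩
  refine (h _).2 ?_
  rintro _ ⟨u, rfl⟩
  have h1 := (h x).1 ⟨u, rfl⟩
  have h2 := (h y).1 ⟨u, rfl⟩
  simp only [smul_eq_mul] at *
  have : t = 1 - s := by linarith
  subst this
  nlinarith [mul_le_mul_of_nonneg_left h1 hs, mul_le_mul_of_nonneg_left h2 ht]

lemma convex_continuous {f : ℝ → ℝ} (h : ConvexOn ℝ univ f) : Continuous f :=
  continuousOn_univ.1 (h.continuousOn isOpen_univ)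

/-! ### Measurable argmax -/

section argmax
variable {J : Type*} [Fintype J] [Nonempty J] [MeasurableSpace J] [DiscreteMeasurableSpace J]

lemma meas_sel {f : J → ℝ → ℝ} (hf : ∀ j, Measurable (f j)) {σ : ℝ → J} (hσ : Measurable σ) :
    Measurable (fun y => f (σ y) y) := by
  have h : Measurable (fun p : J × ℝ => f p.1 p.2) :=
    measurable_from_prod_countable_right fun j => hf j
  exact h.comp (hσ.prodMk measurable_id)

lemma exists_argmax (f : J → ℝ → ℝ) (hf : ∀ j, Measurable (f j)) :
    ∃ σ : ℝ → J, Measurable σ ∧ ∀ y j, f j y ≤ f (σ y) y := by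
  classical
  have : ∀ s : Finset J, ∃ σ : ℝ → J, Measurable σ ∧ ∀ y, ∀ j ∈ s, f j y ≤ f (σ y) y := by
    intro s
    induction s using Finset.induction_on with
    | empty => exact ⟨fun _ => Classical.arbitrary J, measurable_const, by simp⟩
    | insert b s hb ih =>
      obtain ⟨σ, hσ, h⟩ := ih
      refine ⟨fun y => if f (σ y) y ≤ f b y then b else σ y,
        Measurable.ite (measurableSet_le (meas_sel hf hσ) (hf b)) measurable_const hσ, ?_⟩
      intro y j hj
      rcases Finset.mem_insert.1 hj with rfl | hj
      · by_cases h1 : f (σ y) y ≤ f j y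
        · simp [h1]
        · simp only [h1, if_false]; exact (not_le.1 h1).le
      · by_cases h1 : f (σ y) y ≤ f b y
        · simp only [h1, if_true]; exact (h y j hj).trans h1
        · simp only [h1, if_false]; exact h y j hj
  obtain ⟨σ, hσ, h⟩ := this Finset.univ
  exact ⟨σ, hσ, fun y j => h y j (Finset.mem_univ j)⟩

end argmax

/-! ### Minimax -/

lemma minimax_core {J : Type*} [Fintype J] {L : ℝ → ℝ} (hLconv : ConvexOn ℝ univ L)
    (w q : J → ℝ) (hw : ∀ j, 0 ≤ w j) (K : ℝ) (M : Set ((J → ℝ) × (J → ℝ))) (hMc : Convex ℝ M)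
    (hMb : Bornology.IsBounded M) (hMne : M.Nonempty)
    (hdual : ∀ u d : J → ℝ, ∃ x ∈ M,
      ∑ j, (u j * (q j - x.2 j) + d j * (w j - x.1 j) - w j * L (u j)) ≤ K) :
    ∃ x ∈ closure M, ∀ u d : J → ℝ,
      ∑ j, (u j * (q j - x.2 j) + d j * (w j - x.1 j) - w j * L (u j)) ≤ K := by
  have hLc : Continuous L := convex_continuous hLconv
  set f : (J → ℝ) × (J → ℝ) → (J → ℝ) × (J → ℝ) → ℝ := fun x y =>
    ∑ j, (y.1 j * (q j - x.2 j) + y.2 j * (w j - x.1 j) - w j * L (y.1 j)) with hf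
  have hk : IsCompact (closure M) := hMb.isCompact_closure
  have hfc1 : ∀ y, Continuous (fun x => f x y) := fun y => by simp only [hf]; fun_prop
  have hfc2 : ∀ x, Continuous (fun y => f x y) := fun x => by simp only [hf]; fun_prop
  by_contra! hcon
  have hcover : closure M ⊆ ⋃ y : (J → ℝ) × (J → ℝ), {x | K < f x y} := by
    intro x hx
    obtain ⟨u, d, h⟩ := hcon x hx
    exact mem_iUnion.2 ⟨(u, d), h⟩
  obtain ⟨s, hs⟩ := hk.elim_finite_subcover _
    (fun y => isOpen_lt continuous_const (hfc1 y)) hcover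
  obtain ⟨y0, -, hy0⟩ := Sion.exists_lt_iInf_of_lt_iInf_of_finite (X := closure M) (Y := univ)
    (f := f) (ne_X := hMne.closure) (kX := hk)
    (hfy := fun y _ => (hfc1 y).lowerSemicontinuous.lowerSemicontinuousOn _)
    (hfy' := fun y _ => by
      refine ConvexOn.quasiconvexOn ⟨hMc.closure, fun x _ z _ a b ha hb hab => le_of_eq ?_⟩
      simp only [hf, smul_eq_mul, Finset.mul_sum, ← Finset.sum_add_distrib, Prod.fst_add,
        Prod.snd_add, Prod.smul_fst, Prod.smul_snd, Pi.add_apply, Pi.smul_apply]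
      refine Finset.sum_congr rfl fun j _ => ?_
      have : b = 1 - a := by linarith
      subst this; ring)
    (cY := convex_univ)
    (hfx := fun x _ => (hfc2 x).upperSemicontinuous.upperSemicontinuousOn _)
    (hfx' := fun x _ => by
      refine ConcaveOn.quasiconcaveOn ⟨convex_univ, fun y _ z _ a b ha hb hab => ?_⟩
      simp only [hf, smul_eq_mul, Finset.mul_sum, ← Finset.sum_add_distrib, Prod.fst_add,
        Prod.snd_add, Prod.smul_fst, Prod.smul_snd, Pi.add_apply, Pi.smul_apply]
      refine Finset.sum_le_sum fun j _ => ?_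
      have h1 := hLconv.2 (mem_univ (y.1 j)) (mem_univ (z.1 j)) ha hb hab
      simp only [smul_eq_mul] at h1
      nlinarith [mul_le_mul_of_nonneg_left h1 (hw j)])
    (cX := hMc.closure) (s := (s : Set _)) s.finite_toSet (subset_univ _) (t := K)
    (fun x hx => by
      obtain ⟨y, hy, h⟩ := mem_iUnion₂.1 (hs hx)
      exact ⟨y, hy, h⟩)
  obtain ⟨x, hx, h⟩ := hdual y0.1 y0.2
  exact absurd h (not_le.2 (hy0 x (subset_closure hx)))

/-- From the saddle inequality to the cost bound. -/
lemma saddle_cost {J : Type*} [Fintype J] {L θ : ℝ → ℝ} (hL0 : L 0 = 0)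
    (hθ : ∀ x, IsLUB (Set.range fun u => x * u - L u) (θ x))
    (w q m r : J → ℝ) (hw : ∀ j, 0 < w j) (K : ℝ)
    (h : ∀ u d : J → ℝ, ∑ j, (u j * (q j - r j) + d j * (w j - m j) - w j * L (u j)) ≤ K) :
    m = w ∧ ∑ j, w j * θ ((q j - r j) / w j) ≤ K := by
  classical
  constructor
  · funext j
    by_contra hne
    have hne' : w j - m j ≠ 0 := sub_ne_zero.2 (Ne.symm hne)
    have := h 0 (Pi.single j ((|K| + 1) / (w j - m j)))
    simp only [Pi.zero_apply, zero_mul, hL0, mul_zero, zero_add, sub_zero] at this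
    rw [Finset.sum_eq_single j (fun i _ hi => by simp [Pi.single_eq_of_ne hi]) (by simp),
      Pi.single_eq_same, div_mul_cancel₀ _ hne'] at this
    linarith [le_abs_self K]
  · refine le_of_forall_pos_le_add fun ε hε => ?_
    have hex : ∀ j, ∃ u, θ ((q j - r j) / w j) - ε / (∑ j, w j) ≤ (q j - r j) / w j * u - L u := by
      intro j
      have hsum : 0 < ∑ j, w j := Finset.sum_pos (fun j _ => hw j) ⟨j, Finset.mem_univ j⟩
      obtain ⟨_, ⟨u, rfl⟩, hu⟩ := (lt_isLUB_iff (hθ ((q j - r j) / w j))).1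
        (sub_lt_self _ (div_pos hε hsum))
      exact ⟨u, hu.le⟩
    choose u hu using hex
    have h1 := h u 0
    simp only [Pi.zero_apply, zero_mul, add_zero] at h1
    have h2 : ∑ j, w j * (θ ((q j - r j) / w j) - ε / (∑ j, w j)) ≤
        ∑ j, (u j * (q j - r j) - w j * L (u j)) := by
      refine Finset.sum_le_sum fun j _ => ?_
      have := mul_le_mul_of_nonneg_left (hu j) (hw j).le
      refine this.trans (le_of_eq ?_)
      have := (hw j).ne'
      field_simp
    simp only [mul_sub, Finset.sum_sub_distrib] at h2 h1
    rw [← Finset.sum_mul] at h2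
    have h3 : (∑ j, w j) * (ε / ∑ j, w j) ≤ ε := by
      rcases eq_or_ne (∑ j, w j) 0 with h0 | h0
      · rw [h0]; simpa using hε.le
      · rw [mul_div_cancel₀ _ h0]
    linarith

/-! ### Finite coupling -/

lemma finite_coupling {J : Type*} [Fintype J] [Nonempty J] [MeasurableSpace J]
    [DiscreteMeasurableSpace J] {μ : Measure ℝ} [IsProbabilityMeasure μ]
    (hid : Integrable (fun x : ℝ => x) μ) {L θ : ℝ → ℝ} (hLconv : ConvexOn ℝ univ L)
    (hL0 : L 0 = 0) (hθ : ∀ x, IsLUB (Set.range fun u => x * u - L u) (θ x))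
    (w q : J → ℝ) (hw : ∀ j, 0 < w j) (hw1 : ∑ j, w j = 1) (K : ℝ)
    (hdual : ∀ (u d : J → ℝ) (Φ : ℝ → ℝ), Integrable Φ μ → (∀ x i, u i * x + d i ≤ Φ x) →
      ∑ j, (u j * q j + d j * w j - w j * L (u j)) ≤ K + ∫ x, Φ x ∂μ) (ε : ℝ) (hε : 0 < ε) :
    ∃ g : J → ℝ → ℝ, (∀ j, Measurable (g j)) ∧ (∀ j y, 0 ≤ g j y) ∧ (∀ y, ∑ j, g j y = 1) ∧
      (∀ j, ∫ y, g j y ∂μ = w j) ∧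
      ∑ j, w j * θ ((q j - ∫ y, y * g j y ∂μ) / w j) < K + ε := by
  classical
  have hθc : Continuous θ := convex_continuous (conj_convex hθ)
  have hg1 : ∀ g : J → ℝ → ℝ, (∀ j y, 0 ≤ g j y) → (∀ y, ∑ j, g j y = 1) → ∀ j y, g j y ≤ 1 := by
    intro g h0 h1 j y
    rw [← h1 y]
    exact Finset.single_le_sum (f := fun j => g j y) (fun i _ => h0 i y) (Finset.mem_univ j)
  have hI : ∀ g : J → ℝ → ℝ, (∀ j, Measurable (g j)) → (∀ j y, 0 ≤ g j y) →
      (∀ y, ∑ j, g j y = 1) → ∀ j, Integrable (g j) μ ∧ Integrable (fun y => y * g j y) μ := by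
    intro g hm h0 h1 j
    constructor
    · refine (integrable_const (1:ℝ)).mono' (hm j).aestronglyMeasurable (ae_of_all _ fun y => ?_)
      rw [Real.norm_eq_abs, abs_of_nonneg (h0 j y)]; exact hg1 g h0 h1 j y
    · refine hid.abs.mono' (measurable_id.mul (hm j)).aestronglyMeasurable (ae_of_all _ fun y => ?_)
      rw [Real.norm_eq_abs, abs_mul, abs_of_nonneg (h0 j y)]
      exact mul_le_of_le_one_right (abs_nonneg _) (hg1 g h0 h1 j y)
  set M : Set ((J → ℝ) × (J → ℝ)) := {x | ∃ g : J → ℝ → ℝ, (∀ j, Measurable (g j)) ∧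
    (∀ j y, 0 ≤ g j y) ∧ (∀ y, ∑ j, g j y = 1) ∧ x.1 = (fun j => ∫ y, g j y ∂μ) ∧
    x.2 = (fun j => ∫ y, y * g j y ∂μ)} with hM
  have hMc : Convex ℝ M := by
    rintro ⟨m1, r1⟩ ⟨g1, a1, b1, c1, d1, e1⟩ ⟨m2, r2⟩ ⟨g2, a2, b2, c2, d2, e2⟩ s t hs ht hst
    refine ⟨fun j y => s * g1 j y + t * g2 j y, fun j => ((a1 j).const_mul s).add
      ((a2 j).const_mul t), fun j y => add_nonneg (mul_nonneg hs (b1 j y)) (mul_nonneg ht (b2 j y)),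
      fun y => ?_, ?_, ?_⟩
    · rw [Finset.sum_add_distrib, ← Finset.mul_sum, ← Finset.mul_sum, c1, c2]; linarith
    · funext j
      simp only at d1 d2
      simp only [d1, d2, Prod.smul_mk, Prod.mk_add_mk, Pi.add_apply, Pi.smul_apply, smul_eq_mul]
      rw [integral_add ((hI g1 a1 b1 c1 j).1.const_mul s) ((hI g2 a2 b2 c2 j).1.const_mul t),
        integral_const_mul, integral_const_mul]
    · funext j
      simp only at e1 e2
      simp only [e1, e2, Prod.smul_mk, Prod.mk_add_mk, Pi.add_apply, Pi.smul_apply, smul_eq_mul]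
      rw [← integral_const_mul, ← integral_const_mul, ← integral_add
        ((hI g1 a1 b1 c1 j).2.const_mul s) ((hI g2 a2 b2 c2 j).2.const_mul t)]
      refine integral_congr_ae (ae_of_all _ fun y => ?_)
      simp only; ring
  have hMb : Bornology.IsBounded M := by
    refine (Metric.isBounded_closedBall (x := (0 : (J → ℝ) × (J → ℝ)))
      (r := max 1 (∫ y, |y| ∂μ))).subset ?_
    rintro ⟨m, r⟩ ⟨g, a, b, c, d, e⟩
    simp only at d e
    subst d e
    rw [mem_closedBall_zero_iff, Prod.norm_def]
    refine max_le_max ?_ ?_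
    · refine (pi_norm_le_iff_of_nonneg zero_le_one).2 fun j => ?_
      rw [Real.norm_eq_abs, abs_of_nonneg (integral_nonneg (b j))]
      calc ∫ y, g j y ∂μ ≤ ∫ y, (1:ℝ) ∂μ :=
            integral_mono (hI g a b c j).1 (integrable_const _) (hg1 g b c j)
        _ = 1 := by simp
    · refine (pi_norm_le_iff_of_nonneg (integral_nonneg fun y => abs_nonneg y)).2 fun j => ?_
      refine (norm_integral_le_integral_norm _).trans ?_
      refine integral_mono (hI g a b c j).2.norm hid.abs fun y => ?_
      simp only [Real.norm_eq_abs, abs_mul, abs_of_nonneg (b j y)]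
      exact mul_le_of_le_one_right (abs_nonneg _) (hg1 g b c j y)
  have hsel : ∀ σ : ℝ → J, Measurable σ →
      (∀ j, Measurable (fun y => if σ y = j then (1:ℝ) else 0)) ∧
      (∀ j y, 0 ≤ (if σ y = j then (1:ℝ) else 0)) ∧
      (∀ y, ∑ j, (if σ y = j then (1:ℝ) else 0) = 1) := by
    intro σ hσ
    refine ⟨fun j => Measurable.ite (hσ (measurableSet_singleton j)) measurable_const
      measurable_const, fun j y => by split_ifs <;> norm_num, fun y => by simp⟩
  have hMne : M.Nonempty := by
    obtain ⟨h1, h2, h3⟩ := hsel (fun _ => Classical.arbitrary J) measurable_const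
    exact ⟨(_, _), _, h1, h2, h3, rfl, rfl⟩
  obtain ⟨⟨m, r⟩, hx, hxK⟩ := minimax_core hLconv w q (fun j => (hw j).le) K M hMc hMb hMne (by
    intro u d
    obtain ⟨σ, hσ, hmax⟩ := exists_argmax (fun j y => u j * y + d j) (fun j => by fun_prop)
    obtain ⟨h1, h2, h3⟩ := hsel σ hσ
    refine ⟨(_, _), ⟨_, h1, h2, h3, rfl, rfl⟩, ?_⟩
    have h4 := hI _ h1 h2 h3
    have hΦ : ∀ y, u (σ y) * y + d (σ y) = ∑ j, (u j * (y * (if σ y = j then (1:ℝ) else 0)) +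
        d j * (if σ y = j then (1:ℝ) else 0)) := by
      intro y
      simp [Finset.sum_add_distrib]
    have hii : ∀ j, Integrable (fun y => u j * (y * (if σ y = j then (1:ℝ) else 0)) +
        d j * (if σ y = j then (1:ℝ) else 0)) μ := fun j =>
      ((h4 j).2.const_mul _).add ((h4 j).1.const_mul _)
    have h5 := hdual u d (fun y => u (σ y) * y + d (σ y)) (by
      simp only [hΦ]
      exact integrable_finsetSum _ fun j _ => hii j) (fun x i => hmax x i)
    simp only [hΦ] at h5
    rw [integral_finsetSum _ fun j _ => hii j] at h5
    have h6 : ∀ j, ∫ y, (u j * (y * (if σ y = j then (1:ℝ) else 0)) +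
        d j * (if σ y = j then (1:ℝ) else 0)) ∂μ = u j * (∫ y, y * (if σ y = j then (1:ℝ) else 0) ∂μ) +
        d j * ∫ y, (if σ y = j then (1:ℝ) else 0) ∂μ := by
      intro j
      rw [integral_add ((h4 j).2.const_mul _) ((h4 j).1.const_mul _), integral_const_mul,
        integral_const_mul]
    simp only [h6] at h5
    rw [← sub_le_iff_le_add, ← Finset.sum_sub_distrib] at h5
    refine le_trans (le_of_eq ?_) h5
    refine Finset.sum_congr rfl fun j _ => ?_
    ring)
  obtain ⟨hmw, hcost⟩ := saddle_cost hL0 hθ w q m r hw K hxK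
  subst hmw
  set b : ℝ := ∫ y, y ∂μ with hb
  set F : ℝ → (J → ℝ) × (J → ℝ) → ℝ := fun η x =>
    ∑ j, m j * θ ((q j - ((1 - η) * x.2 j + (m j - (1 - η) * x.1 j) * b)) / m j) with hF
  have hF1 : Continuous (fun η => F η (m, r)) := by simp only [hF]; fun_prop
  have hF2 : ∀ η, Continuous (F η) := fun η => by simp only [hF]; fun_prop
  have hF0 : F 0 (m, r) < K + ε := by simp only [hF]; simp; linarith
  obtain ⟨η, ⟨hη1, hη2⟩, hηp⟩ : ∃ η, (F η (m, r) < K + ε ∧ η < 1) ∧ 0 < η := by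
    have e1 : ∀ᶠ η in 𝓝[>] (0:ℝ), F η (m, r) < K + ε :=
      (hF1.tendsto 0).eventually (gt_mem_nhds hF0) |>.filter_mono nhdsWithin_le_nhds
    have e2 : ∀ᶠ η in 𝓝[>] (0:ℝ), η < 1 :=
      (gt_mem_nhds zero_lt_one : ∀ᶠ η in 𝓝 (0:ℝ), η < 1).filter_mono nhdsWithin_le_nhds
    exact ((e1.and e2).and self_mem_nhdsWithin).exists
  have hopen : IsOpen ({x : (J → ℝ) × (J → ℝ) | F η x < K + ε} ∩
      ⋂ j, {x : (J → ℝ) × (J → ℝ) | 0 < m j - (1 - η) * x.1 j}) :=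
    (isOpen_lt (hF2 η) continuous_const).inter
      (isOpen_iInter_of_finite fun j => isOpen_lt continuous_const (by fun_prop))
  obtain ⟨⟨m', r'⟩, ⟨hx1, hx2⟩, g, ga, gb, gc, gd, ge⟩ := mem_closure_iff.1 hx _ hopen
    ⟨hη1, mem_iInter.2 fun j => by
      simp only [mem_setOf_eq]; nlinarith [mul_pos hηp (hw j)]⟩
  simp only at gd ge
  simp only [mem_iInter, mem_setOf_eq] at hx1 hx2
  have hgI := hI g ga gb gc
  have hm1 : ∑ j, m' j = 1 := by
    rw [gd, ← integral_finsetSum _ fun j _ => (hgI j).1]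
    simp [gc]
  refine ⟨fun j y => (1 - η) * g j y + (m j - (1 - η) * m' j),
    fun j => ((ga j).const_mul _).add_const _, fun j y =>
      add_nonneg (mul_nonneg (by linarith) (gb j y)) (hx2 j).le, fun y => ?_, fun j => ?_, ?_⟩
  · rw [Finset.sum_add_distrib, Finset.sum_sub_distrib, ← Finset.mul_sum, ← Finset.mul_sum, gc,
      hm1, hw1]; ring
  · rw [integral_add ((hgI j).1.const_mul _) (integrable_const _), integral_const_mul,
      integral_const, ← congrFun gd j]
    simp
  · refine lt_of_eq_of_lt ?_ hx1
    simp only [hF]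
    refine Finset.sum_congr rfl fun j _ => ?_
    have : ∫ y, y * ((1 - η) * g j y + (m j - (1 - η) * m' j)) ∂μ =
        (1 - η) * r' j + (m j - (1 - η) * m' j) * b := by
      rw [congrFun ge j, hb, ← integral_const_mul, ← integral_const_mul, ← integral_add
        ((hgI j).2.const_mul _) (hid.const_mul _)]
      refine integral_congr_ae (ae_of_all _ fun y => ?_)
      simp only; ring
    rw [this]

/-! ### From the finite coupling to a kernel -/

lemma weakCost_le_of_finite {J : Type*} [Fintype J] [Nonempty J] [MeasurableSpace J]
    [DiscreteMeasurableSpace J] {μ ν : Measure ℝ} [IsProbabilityMeasure μ]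
    [IsProbabilityMeasure ν] (T : ℝ → ℝ)
    (i : ℝ → J) (hi : Measurable i) (w : J → ℝ) (hw : ∀ j, 0 < w j)
    (hwν : ∀ j, ν (i ⁻¹' {j}) = ENNReal.ofReal (w j))
    (g : J → ℝ → ℝ) (ga : ∀ j, Measurable (g j)) (gb : ∀ j y, 0 ≤ g j y)
    (gc : ∀ y, ∑ j, g j y = 1) (gd : ∀ j, ∫ y, g j y ∂μ = w j) :
    weakCost T μ ν ≤
      ∫⁻ x, ENNReal.ofReal (T |x - (∫ y, y * g (i x) y ∂μ) / w (i x)|) ∂ν := by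
  set f : J → Measure ℝ := fun j => μ.withDensity (fun y => ENNReal.ofReal (g j y / w j)) with hf
  have hmeas : ∀ j, Measurable (fun y => ENNReal.ofReal (g j y / w j)) := fun j =>
    ((ga j).div_const _).ennreal_ofReal
  have hprob : ∀ j, IsProbabilityMeasure (f j) := by
    intro j
    constructor
    simp only [hf]
    rw [withDensity_apply _ MeasurableSet.univ, Measure.restrict_univ,
      ← ofReal_integral_eq_lintegral_ofReal]
    · rw [integral_div, gd, div_self (hw j).ne', ENNReal.ofReal_one]
    · refine (Integrable.of_integral_ne_zero ?_).div_const _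
      rw [gd]; exact (hw j).ne'
    · exact ae_of_all _ fun y => div_nonneg (gb j y) (hw j).le
  set p : Kernel ℝ ℝ := (Kernel.ofFunOfCountable f).comap i hi with hp
  have hpx : ∀ x, p x = f (i x) := fun x => rfl
  have hpm : IsMarkovKernel p := ⟨fun x => by rw [hpx]; exact hprob _⟩
  have hbind : ν.bind (fun x => p x) = μ := by
    ext s hs
    rw [Measure.bind_apply hs p.measurable.aemeasurable]
    have : ∫⁻ x, p x s ∂ν = ∫⁻ j, f j s ∂(ν.map i) := by
      rw [lintegral_map (measurable_of_countable _) hi]; rfl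
    rw [this, lintegral_fintype]
    have h2 : ∀ j, f j s * (ν.map i) {j} = ∫⁻ y in s, ENNReal.ofReal (g j y) ∂μ := by
      intro j
      rw [Measure.map_apply hi (measurableSet_singleton j), hwν]
      simp only [hf]
      rw [withDensity_apply _ hs, ← lintegral_mul_const _ (hmeas j)]
      refine lintegral_congr fun y => ?_
      rw [← ENNReal.ofReal_mul (div_nonneg (gb j y) (hw j).le), div_mul_cancel₀ _ (hw j).ne']
    simp only [h2]
    rw [← lintegral_finsetSum _ fun j _ => (ga j).ennreal_ofReal]
    have h3 : ∀ y, ∑ j, ENNReal.ofReal (g j y) = 1 := by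
      intro y
      rw [← ENNReal.ofReal_sum_of_nonneg fun j _ => gb j y, gc, ENNReal.ofReal_one]
    simp [h3]
  have hmean : ∀ x, ∫ y, y ∂(p x) = (∫ y, y * g (i x) y ∂μ) / w (i x) := by
    intro x
    rw [hpx]
    simp only [hf]
    rw [integral_withDensity_eq_integral_toReal_smul (hmeas _) (ae_of_all _ fun _ =>
      ENNReal.ofReal_lt_top), ← integral_div]
    refine integral_congr_ae (ae_of_all _ fun y => ?_)
    simp only [smul_eq_mul]
    rw [ENNReal.toReal_ofReal (div_nonneg (gb _ y) (hw _).le)]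
    ring
  unfold weakCost
  refine (iInf_le_of_le p (iInf_le_of_le hpm (iInf_le_of_le hbind le_rfl))).trans ?_
  refine lintegral_mono fun x => ?_
  rw [hmean]

/-! ### The conjugate cost -/

lemma th_nonneg {L θ : ℝ → ℝ} (hL0 : L 0 = 0)
    (hθ : ∀ x, IsLUB (Set.range fun u => x * u - L u) (θ x)) (x : ℝ) : 0 ≤ θ x := by
  have := (hθ x).1 ⟨0, rfl⟩
  simpa [hL0] using this

lemma th_zero {L θ : ℝ → ℝ} (hL0 : L 0 = 0) (hLnn : ∀ x, 0 ≤ L x)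
    (hθ : ∀ x, IsLUB (Set.range fun u => x * u - L u) (θ x)) : θ 0 = 0 := by
  refine le_antisymm ((hθ 0).2 ?_) (th_nonneg hL0 hθ 0)
  rintro _ ⟨u, rfl⟩
  simpa using hLnn u

lemma th_neg {L θ : ℝ → ℝ} (hLeven : ∀ x, L (-x) = L x)
    (hθ : ∀ x, IsLUB (Set.range fun u => x * u - L u) (θ x)) (x : ℝ) : θ (-x) = θ x := by
  have key : ∀ x, θ (-x) ≤ θ x := by
    intro x
    refine (hθ (-x)).2 ?_
    rintro _ ⟨u, rfl⟩
    have := (hθ x).1 ⟨-u, rfl⟩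
    simp only [hLeven] at this
    simp only
    linarith
  exact le_antisymm (key x) (by simpa using key (-x))

lemma th_abs {L θ : ℝ → ℝ} (hLeven : ∀ x, L (-x) = L x)
    (hθ : ∀ x, IsLUB (Set.range fun u => x * u - L u) (θ x)) (x : ℝ) : θ |x| = θ x := by
  rcases abs_choice x with h | h <;> rw [h]
  exact th_neg hLeven hθ x

lemma th_scale {L θ : ℝ → ℝ} (hL0 : L 0 = 0) (hLnn : ∀ x, 0 ≤ L x)
    (hθ : ∀ x, IsLUB (Set.range fun u => x * u - L u) (θ x)) {t : ℝ} (ht : 0 ≤ t) (ht1 : t ≤ 1)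
    (x : ℝ) : θ (t * x) ≤ t * θ x := by
  have := (conj_convex hθ).2 (mem_univ x) (mem_univ 0) ht (sub_nonneg.2 ht1) (by ring)
  simpa [th_zero hL0 hLnn hθ] using this

lemma th_mono {L θ : ℝ → ℝ} (hL0 : L 0 = 0) (hLnn : ∀ x, 0 ≤ L x) (hLeven : ∀ x, L (-x) = L x)
    (hθ : ∀ x, IsLUB (Set.range fun u => x * u - L u) (θ x)) {x y : ℝ} (h : |x| ≤ |y|) :
    θ x ≤ θ y := by
  rw [← th_abs hLeven hθ x, ← th_abs hLeven hθ y]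
  rcases eq_or_lt_of_le (abs_nonneg y) with h0 | h0
  · have : |x| = |y| := le_antisymm h (by rw [← h0]; exact abs_nonneg x)
    rw [this]
  · have h1 : |x| / |y| ≤ 1 := (div_le_one h0).2 h
    have := th_scale hL0 hLnn hθ (div_nonneg (abs_nonneg x) h0.le) h1 |y|
    rw [div_mul_cancel₀ _ h0.ne'] at this
    refine this.trans (mul_le_of_le_one_left (th_nonneg hL0 hθ _) h1)

lemma th_doubling {L θ : ℝ → ℝ} 
    (hθ : ∀ x, IsLUB (Set.range fun u => x * u - L u) (θ x)) {A α : ℝ} (hA : 1 ≤ A) (hα : 1 < α)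
    (hsc : ∀ x : ℝ, ∀ s ∈ Icc (0:ℝ) 1, L (s * x) ≤ A * s ^ α * L x) (l : ℝ) (hl : 1 ≤ l) :
    ∃ D : ℝ, 0 ≤ D ∧ ∀ z, θ (l * z) ≤ D * θ z := by
  have hAl : 1 ≤ A * l := by nlinarith
  have hAl0 : 0 < A * l := by linarith
  set s : ℝ := (A * l) ^ (-(1 / (α - 1))) with hs
  have hs0 : 0 < s := Real.rpow_pos_of_pos hAl0 _
  have hs1 : s ≤ 1 := Real.rpow_le_one_of_one_le_of_nonpos hAl
    (neg_nonpos.2 (div_nonneg zero_le_one (by linarith)))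
  have hsa : A * s ^ α = s / l := by
    have e1 : s ^ (α - 1) = (A * l)⁻¹ := by
      rw [hs, ← Real.rpow_mul hAl0.le]
      have : -(1 / (α - 1)) * (α - 1) = -1 := by
        have : α - 1 ≠ 0 := by linarith
        field_simp
      rw [this, Real.rpow_neg_one]
    have e2 : s ^ α = s * s ^ (α - 1) := by
      conv_rhs => rw [← Real.rpow_one_add' hs0.le (by linarith)]
      congr 1; ring
    have hA0 : A ≠ 0 := by linarith
    have hl0 : l ≠ 0 := by linarith
    rw [e2, e1]
    field_simp
  refine ⟨l / s, by positivity, fun z => (hθ _).2 ?_⟩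
  rintro _ ⟨u, rfl⟩
  have h1 := hsc u s ⟨hs0.le, hs1⟩
  rw [hsa] at h1
  have h2 := (hθ z).1 ⟨s * u, rfl⟩
  simp only at h2 ⊢
  have h3 : l / s * L (s * u) ≤ L u := by
    have : l / s * (s / l * L u) = L u := by
      have hl0 : l ≠ 0 := by linarith
      field_simp
    rw [← this]
    exact mul_le_mul_of_nonneg_left h1 (by positivity)
  have h4 := mul_le_mul_of_nonneg_left h2 (show 0 ≤ l / s by positivity)
  have h5 : l / s * (z * (s * u) - L (s * u)) = l * z * u - l / s * L (s * u) := by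
    field_simp
  linarith

lemma th_split {L θ : ℝ → ℝ} (hL0 : L 0 = 0)
    (hθ : ∀ x, IsLUB (Set.range fun u => x * u - L u) (θ x)) {D : ℝ}
    (hD : ∀ z, θ (2 * z) ≤ D * θ z) {δ : ℝ} (hδ : 0 < δ) (hδ1 : δ ≤ 1) (p q : ℝ) :
    θ (p + q) ≤ (1 + δ * D) * θ p + θ ((1 + δ) / δ * q) := by
  have hc := conj_convex hθ
  have h0 := th_nonneg hL0 hθ
  have h1 := hc.2 (mem_univ p) (mem_univ (2 * p)) (sub_nonneg.2 hδ1) hδ.le (by ring)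
  simp only [smul_eq_mul] at h1
  have h2 := hc.2 (mem_univ ((1 - δ) * p + δ * (2 * p))) (mem_univ ((1 + δ) / δ * q))
    (show 0 ≤ 1 / (1 + δ) by positivity) (show 0 ≤ δ / (1 + δ) by positivity) (by field_simp)
  simp only [smul_eq_mul] at h2
  have h3 : 1 / (1 + δ) * ((1 - δ) * p + δ * (2 * p)) + δ / (1 + δ) * ((1 + δ) / δ * q) = p + q := by
    field_simp; ring
  rw [h3] at h2
  have h4 : 1 / (1 + δ) ≤ 1 := (div_le_one (by positivity)).2 (by linarith)
  have h5 : δ / (1 + δ) ≤ 1 := (div_le_one (by positivity)).2 (by linarith)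
  have h6 := mul_le_of_le_one_left (h0 ((1 - δ) * p + δ * (2 * p))) h4
  have h7 := mul_le_of_le_one_left (h0 ((1 + δ) / δ * q)) h5
  nlinarith [mul_le_mul_of_nonneg_left (hD p) hδ.le, mul_nonneg hδ.le (h0 p)]

lemma th_half {L θ : ℝ → ℝ}
    (hθ : ∀ x, IsLUB (Set.range fun u => x * u - L u) (θ x)) (p q : ℝ) :
    θ (p + q) ≤ 1 / 2 * θ (2 * p) + 1 / 2 * θ (2 * q) := by
  have := (conj_convex hθ).2 (mem_univ (2 * p)) (mem_univ (2 * q))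
    (show (0:ℝ) ≤ 1 / 2 by norm_num) (show (0:ℝ) ≤ 1 / 2 by norm_num) (by norm_num)
  simp only [smul_eq_mul] at this
  have e : 1 / 2 * (2 * p) + 1 / 2 * (2 * q) = p + q := by ring
  rwa [e] at this

lemma th_chernoff {L θ : ℝ → ℝ} (hL0 : L 0 = 0) (hLnn : ∀ x, 0 ≤ L x)
    (hLeven : ∀ x, L (-x) = L x)
    (hθ : ∀ x, IsLUB (Set.range fun u => x * u - L u) (θ x)) (k : ℝ) (hk : 0 ≤ k) :
    ∃ u : ℝ, ∀ z, k ≤ θ z → k - 1 ≤ |u| * |z| - L u := by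
  rcases eq_or_lt_of_le hk with rfl | hk
  · exact ⟨0, fun z _ => by simp [hL0]⟩
  by_cases hex : ∃ z, k ≤ θ z
  · obtain ⟨z0, hz0⟩ := hex
    have hc : Continuous θ := convex_continuous (conj_convex hθ)
    obtain ⟨s, ⟨hs0, -⟩, hs⟩ := intermediate_value_Icc (abs_nonneg z0) hc.continuousOn
      (show k ∈ Icc (θ 0) (θ |z0|) from
        ⟨by rw [th_zero hL0 hLnn hθ]; exact hk.le, by rw [th_abs hLeven hθ]; exact hz0⟩)
    obtain ⟨_, ⟨u, rfl⟩, hu⟩ := (lt_isLUB_iff (hθ s)).1 (sub_one_lt (θ s))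
    refine ⟨u, fun z hz => ?_⟩
    have hsz : s ≤ |z| := by
      by_contra hlt
      push Not at hlt
      have hs' : 0 < s := (abs_nonneg z).trans_lt hlt
      have h1 := th_scale hL0 hLnn hθ (div_nonneg (abs_nonneg z) hs0)
        ((div_le_one hs').2 hlt.le) s
      rw [div_mul_cancel₀ _ hs'.ne', th_abs hLeven hθ, hs] at h1
      have h2 : |z| / s * k < k := mul_lt_of_lt_one_left hk ((div_lt_one hs').2 hlt)
      linarith
    have h3 : s * u ≤ |u| * |z| := by
      calc s * u ≤ s * |u| := mul_le_mul_of_nonneg_left (le_abs_self u) hs0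
        _ = |u| * s := mul_comm _ _
        _ ≤ _ := mul_le_mul_of_nonneg_left hsz (abs_nonneg u)
    simp only at hu
    rw [hs] at hu
    linarith
  · push Not at hex
    exact ⟨0, fun z hz => absurd hz (not_le.2 (hex z))⟩

lemma th_exp_int {L θ : ℝ → ℝ} (hL0 : L 0 = 0) (hLnn : ∀ x, 0 ≤ L x)
    (hLeven : ∀ x, L (-x) = L x)
    (hθ : ∀ x, IsLUB (Set.range fun u => x * u - L u) (θ x)) {μ : Measure ℝ} (m : ℝ)
    (hmgf : ∀ u, Integrable (fun x => Real.exp (u * x - u * m - L u)) μ ∧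
      ∫ x, Real.exp (u * x - u * m - L u) ∂μ ≤ 1) :
    Integrable (fun x => Real.exp (θ (x - m) / 2)) μ := by
  have hc : Continuous θ := convex_continuous (conj_convex hθ)
  choose u hu using fun k : ℕ => th_chernoff hL0 hLnn hLeven hθ k (Nat.cast_nonneg k)
  set h : ℕ → ℝ → ℝ := fun k x => Real.exp ((3 - k) / 2) *
    (Real.exp (|u k| * x - |u k| * m - L |u k|) + Real.exp (-|u k| * x - -|u k| * m - L (-|u k|)))
    with hh
  have hLabs : ∀ v, L |v| = L v := by
    intro v; rcases abs_choice v with h | h <;> rw [h]; exact hLeven v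
  have hpt : ∀ x, ∃ k, Real.exp (θ (x - m) / 2) ≤ h k x := by
    intro x
    have hn := th_nonneg hL0 hθ (x - m)
    refine ⟨⌊θ (x - m)⌋₊, ?_⟩
    have h1 := hu ⌊θ (x - m)⌋₊ (x - m) (Nat.floor_le hn)
    have h2 := Nat.lt_floor_add_one (θ (x - m))
    set k := ⌊θ (x - m)⌋₊
    have h3 : Real.exp (k - 1) ≤ Real.exp (|u k| * x - |u k| * m - L |u k|) +
        Real.exp (-|u k| * x - -|u k| * m - L (-|u k|)) := by
      rw [hLeven, hLabs]
      rcases abs_cases (x - m) with ⟨e, -⟩ | ⟨e, -⟩ <;> rw [e] at h1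
      · refine (Real.exp_le_exp.2 ?_).trans (le_add_of_nonneg_right (Real.exp_pos _).le)
        linarith
      · refine (Real.exp_le_exp.2 ?_).trans (le_add_of_nonneg_left (Real.exp_pos _).le)
        linarith
    calc Real.exp (θ (x - m) / 2) ≤ Real.exp ((3 - k) / 2) * Real.exp (k - 1) := by
          rw [← Real.exp_add]; apply Real.exp_le_exp.2; linarith
      _ ≤ _ := mul_le_mul_of_nonneg_left h3 (Real.exp_pos _).le
  have hmeas : Measurable (fun x => Real.exp (θ (x - m) / 2)) := by fun_prop
  refine ⟨hmeas.aestronglyMeasurable, ?_⟩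
  rw [hasFiniteIntegral_iff_ofReal (ae_of_all _ fun x => (Real.exp_pos _).le)]
  have hhm : ∀ k, Measurable (h k) := fun k => by simp only [hh]; fun_prop
  have hhi : ∀ k, ∫⁻ x, ENNReal.ofReal (h k x) ∂μ ≤ ENNReal.ofReal (2 * Real.exp ((3 - k) / 2)) := by
    intro k
    obtain ⟨a1, a2⟩ := hmgf |u k|
    obtain ⟨b1, b2⟩ := hmgf (-|u k|)
    have hki : Integrable (h k) μ := (a1.add b1).const_mul _
    rw [← ofReal_integral_eq_lintegral_ofReal hki
      (ae_of_all _ fun x => by simp only [hh, Pi.zero_apply]; positivity)]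
    apply ENNReal.ofReal_le_ofReal
    simp only [hh]
    rw [integral_const_mul, integral_add a1 b1]
    nlinarith [Real.exp_pos ((3 - (k:ℝ)) / 2)]
  calc ∫⁻ x, ENNReal.ofReal (Real.exp (θ (x - m) / 2)) ∂μ
      ≤ ∫⁻ x, ∑' k, ENNReal.ofReal (h k x) ∂μ := by
        refine lintegral_mono fun x => ?_
        obtain ⟨k, hk⟩ := hpt x
        exact (ENNReal.ofReal_le_ofReal hk).trans
          (ENNReal.le_tsum (f := fun k => ENNReal.ofReal (h k x)) k)
    _ = ∑' k, ∫⁻ x, ENNReal.ofReal (h k x) ∂μ :=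
        lintegral_tsum fun k => (hhm k).ennreal_ofReal.aemeasurable
    _ ≤ ∑' k : ℕ, ENNReal.ofReal (2 * Real.exp ((3 - k) / 2)) := ENNReal.tsum_le_tsum hhi
    _ < ⊤ := by
      have hs : Summable fun k : ℕ => 2 * Real.exp ((3 - k) / 2) := by
        have h1 : Summable fun k : ℕ => (Real.exp (-(1 / 2))) ^ k :=
          summable_geometric_of_lt_one (Real.exp_pos _).le (Real.exp_lt_one_iff.2 (by norm_num))
        refine (h1.mul_left (2 * Real.exp (3 / 2))).congr fun k => ?_
        rw [← Real.exp_nat_mul, mul_assoc, ← Real.exp_add]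
        congr 2; ring
      rw [← ENNReal.ofReal_tsum_of_nonneg (fun k => by positivity) hs]
      exact ENNReal.ofReal_lt_top

lemma th_int_nu {Y : ℝ → ℝ} (hY : Measurable Y) (hY0 : ∀ x, 0 ≤ Y x) {ν μ : Measure ℝ}
    [IsProbabilityMeasure ν] [IsProbabilityMeasure μ] (hac : ν ≪ μ)
    (hllr : Integrable (fun x => Real.log ((ν.rnDeriv μ x).toReal)) ν)
    (hE : Integrable (fun x => Real.exp (Y x / 2)) μ) : Integrable Y ν := by
  set C := (∫ x, Real.log ((ν.rnDeriv μ x).toReal) ∂ν) + Real.log (∫ x, Real.exp (Y x / 2) ∂μ)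
  have hn : ∀ n : ℕ, ∫⁻ x, ENNReal.ofReal (min (Y x) n / 2) ∂ν ≤ ENNReal.ofReal C := by
    intro n
    have hm : Measurable (fun x => min (Y x) n / 2) := (hY.min measurable_const).div_const _
    have h0 : ∀ x, 0 ≤ min (Y x) n / 2 := fun x =>
      div_nonneg (le_min (hY0 x) (Nat.cast_nonneg n)) two_pos.le
    have h1 : Integrable (fun x => min (Y x) n / 2) ν := by
      refine (integrable_const (n:ℝ)).mono' hm.aestronglyMeasurable (ae_of_all _ fun x => ?_)
      rw [Real.norm_eq_abs, abs_of_nonneg (h0 x)]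
      have := min_le_right (Y x) n
      have := h0 x
      linarith
    have h2 : Integrable (fun x => Real.exp (min (Y x) n / 2)) μ := by
      refine hE.mono' hm.exp.aestronglyMeasurable (ae_of_all _ fun x => ?_)
      rw [Real.norm_eq_abs, abs_of_pos (Real.exp_pos _)]
      apply Real.exp_le_exp.2
      have := min_le_left (Y x) n
      linarith
    rw [← ofReal_integral_eq_lintegral_ofReal h1 (ae_of_all _ h0)]
    apply ENNReal.ofReal_le_ofReal
    refine (gibbs hac hllr h1 h2).trans ?_
    refine add_le_add le_rfl (Real.log_le_log (integral_exp_pos h2) ?_)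
    refine integral_mono h2 hE fun x => ?_
    apply Real.exp_le_exp.2
    have := min_le_left (Y x) n
    linarith
  have ht : Tendsto (fun n : ℕ => ∫⁻ x, ENNReal.ofReal (min (Y x) n / 2) ∂ν) atTop
      (𝓝 (∫⁻ x, ENNReal.ofReal (Y x / 2) ∂ν)) := by
    refine lintegral_tendsto_of_tendsto_of_monotone
      (fun n => ((hY.min measurable_const).div_const _).ennreal_ofReal.aemeasurable)
      (ae_of_all _ fun x a b hab => ?_) (ae_of_all _ fun x => ?_)
    · apply ENNReal.ofReal_le_ofReal
      have : min (Y x) a ≤ min (Y x) b := min_le_min_left _ (Nat.cast_le.2 hab)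
      linarith
    · refine tendsto_const_nhds.congr' ?_
      filter_upwards [eventually_ge_atTop ⌈Y x⌉₊] with n hn
      rw [min_eq_left ((Nat.le_ceil _).trans (Nat.cast_le.2 hn))]
  have hle := le_of_tendsto' ht hn
  have h2 : Integrable (fun x => Y x / 2) ν := by
    refine ⟨(hY.div_const _).aestronglyMeasurable, ?_⟩
    rw [hasFiniteIntegral_iff_ofReal (ae_of_all _ fun x => div_nonneg (hY0 x) two_pos.le)]
    exact hle.trans_lt ENNReal.ofReal_lt_top
  refine (h2.const_mul 2).congr (ae_of_all _ fun x => ?_)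
  simp only; ring

lemma th_int_all {L θ : ℝ → ℝ} (hL0 : L 0 = 0) (hLnn : ∀ x, 0 ≤ L x)
    (hLeven : ∀ x, L (-x) = L x)
    (hθ : ∀ x, IsLUB (Set.range fun u => x * u - L u) (θ x)) 
    (hdb : ∀ l : ℝ, 1 ≤ l → ∃ D : ℝ, 0 ≤ D ∧ ∀ z, θ (l * z) ≤ D * θ z)
    {ν : Measure ℝ} [IsProbabilityMeasure ν] (m : ℝ)
    (hY : Integrable (fun x => θ (x - m)) ν) (κ : ℝ) : Integrable (fun x => θ (κ * x)) ν := by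
  have hc : Continuous θ := convex_continuous (conj_convex hθ)
  obtain ⟨D, hD0, hD⟩ := hdb (max 1 |2 * κ|) (le_max_left _ _)
  refine ((hY.const_mul (1 / 2 * D)).add (integrable_const (1 / 2 * θ (2 * (κ * m))))).mono'
    (by fun_prop) (ae_of_all _ fun x => ?_)
  rw [Real.norm_eq_abs, abs_of_nonneg (th_nonneg hL0 hθ _)]
  have h1 := th_half hθ (κ * (x - m)) (κ * m)
  have e : κ * (x - m) + κ * m = κ * x := by ring
  rw [e] at h1
  have h2 : θ (2 * (κ * (x - m))) ≤ θ (max 1 |2 * κ| * (x - m)) := by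
    apply th_mono hL0 hLnn hLeven hθ
    rw [← mul_assoc, abs_mul, abs_mul (max 1 |2 * κ|)]
    exact mul_le_mul_of_nonneg_right ((le_max_right _ _).trans (le_abs_self _)) (abs_nonneg _)
  have h3 := hD (x - m)
  simp only [Pi.add_apply]
  linarith

/-! ### Discretisation -/

lemma exists_disc {ν : Measure ℝ} [IsProbabilityMeasure ν] (S : SimpleFunc ℝ ℝ) :
    ∃ (F : Finset ℝ) (i : ℝ → F), Nonempty F ∧ Measurable i ∧ (∀ j, ν (i ⁻¹' {j}) ≠ 0) ∧
      ∀ᵐ x ∂ν, S x = (i x : ℝ) := by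
  classical
  set F : Finset ℝ := S.range.filter (fun v => ν (S ⁻¹' {v}) ≠ 0) with hF
  have hae : ∀ᵐ x ∂ν, S x ∈ F := by
    have : ∀ᵐ x ∂ν, ∀ v ∈ S.range.filter (fun v => ν (S ⁻¹' {v}) = 0), S x ≠ v := by
      rw [Filter.eventually_all_finset]
      intro v hv
      have := (Finset.mem_filter.1 hv).2
      rw [ae_iff]
      convert this using 2
      ext x; simp
    filter_upwards [this] with x hx
    by_contra hcon
    refine hx (S x) (Finset.mem_filter.2 ⟨SimpleFunc.mem_range_self S x, ?_⟩) rfl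
    by_contra h0
    exact hcon (Finset.mem_filter.2 ⟨SimpleFunc.mem_range_self S x, h0⟩)
  obtain ⟨x0, hx0⟩ := hae.exists
  have hne : Nonempty F := ⟨⟨S x0, hx0⟩⟩
  set f : ℝ → F := fun v => if h : v ∈ F then ⟨v, h⟩ else Classical.arbitrary F with hf
  refine ⟨F, fun x => f (S x), hne, ?_, ?_, ?_⟩
  · refine measurable_to_countable' fun j => ?_
    exact SimpleFunc.measurableSet_preimage S (f ⁻¹' {j})
  · intro j h0
    have h1 := (Finset.mem_filter.1 j.2).2
    refine h1 (measure_mono_null ?_ h0)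
    intro x hx
    have hx' : S x = j := hx
    have : S x ∈ F := by rw [hx']; exact j.2
    simp only [mem_preimage, mem_singleton_iff, hf, this, dif_pos]
    exact Subtype.ext hx'
  · filter_upwards [hae] with x hx
    simp only [hf, hx, dif_pos]

lemma int_fiber {J : Type*} [Fintype J] [MeasurableSpace J] [DiscreteMeasurableSpace J]
    {ν : Measure ℝ} {i : ℝ → J} (hi : Measurable i) (f : J → ℝ → ℝ)
    (hf : ∀ j, Integrable (f j) ν) :
    Integrable (fun x => f (i x) x) ν ∧
      ∫ x, f (i x) x ∂ν = ∑ j, ∫ x in i ⁻¹' {j}, f j x ∂ν := by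
  classical
  have hm : ∀ j, MeasurableSet (i ⁻¹' {j}) := fun j => hi (measurableSet_singleton j)
  have e : ∀ x, f (i x) x = ∑ j, (i ⁻¹' {j}).indicator (f j) x := by
    intro x
    rw [Finset.sum_eq_single (i x)]
    · rw [indicator_of_mem]; simp
    · intro b _ hb
      rw [indicator_of_notMem]
      simpa using Ne.symm hb
    · simp
  have h1 : ∀ j, Integrable ((i ⁻¹' {j}).indicator (f j)) ν := fun j => (hf j).indicator (hm j)
  simp only [e]
  refine ⟨integrable_finsetSum _ fun j _ => h1 j, ?_⟩
  rw [integral_finsetSum _ fun j _ => h1 j]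
  exact Finset.sum_congr rfl fun j _ => integral_indicator (hm j)

lemma disc_bound {F : Finset ℝ} [Nonempty F] {μ ν : Measure ℝ} [IsProbabilityMeasure μ]
    [IsProbabilityMeasure ν]
    (hid : Integrable (fun x : ℝ => x) μ) (hidν : Integrable (fun x : ℝ => x) ν)
    {L θ : ℝ → ℝ} (hLconv : ConvexOn ℝ univ L)
    (hL0 : L 0 = 0) (hLeven : ∀ x, L (-x) = L x)
    (hθ : ∀ x, IsLUB (Set.range fun u => x * u - L u) (θ x))
    {D : ℝ} (hD : ∀ z, θ (2 * z) ≤ D * θ z) (hD0 : 0 ≤ D)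
    (hInt : ∀ κ s : ℝ, Integrable (fun x => θ (κ * (x - s))) ν) (K : ℝ)
    (i : ℝ → F) (hi : Measurable i) (hi0 : ∀ j, ν (i ⁻¹' {j}) ≠ 0)
    (hdual : ∀ (u d : F → ℝ) (Φ : ℝ → ℝ), Integrable Φ μ → (∀ x j, u j * x + d j ≤ Φ x) →
      ∫ x, (u (i x) * x + d (i x) - L (u (i x))) ∂ν ≤ K + ∫ x, Φ x ∂μ)
    {δ : ℝ} (hδ : 0 < δ) (hδ1 : δ ≤ 1)
    (hsmall : ∫ x, θ (2 * ((1 + δ) / δ) * (x - i x)) ∂ν < δ) :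
    weakCost θ μ ν ≤ ENNReal.ofReal ((1 + δ * D) * (K + δ) + δ) := by
  have hθ0 := th_nonneg hL0 hθ
  have hθc : Continuous θ := convex_continuous (conj_convex hθ)
  set κ := (1 + δ) / δ with hκ
  set w : F → ℝ := fun j => ν.real (i ⁻¹' {j}) with hwdef
  set q : F → ℝ := fun j => ∫ x in i ⁻¹' {j}, x ∂ν with hqdef
  have hw : ∀ j, 0 < w j := fun j => ENNReal.toReal_pos (hi0 j) (measure_ne_top _ _)
  have hconst : ∀ (f : F → ℝ), ∫ x, f (i x) ∂ν = ∑ j, w j * f j := by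
    intro f
    rw [(int_fiber hi (fun j _ => f j) fun j => integrable_const _).2]
    refine Finset.sum_congr rfl fun j _ => ?_
    rw [setIntegral_const, smul_eq_mul]
  have hconsti : ∀ (f : F → ℝ), Integrable (fun x => f (i x)) ν := fun f =>
    (int_fiber hi (fun j _ => f j) fun j => integrable_const _).1
  have hw1 : ∑ j, w j = 1 := by
    have := hconst fun _ => 1
    simpa using this.symm
  obtain ⟨g, ga, gb, gc, gd, ge⟩ := finite_coupling hid hLconv hL0 hθ w q hw hw1 K (by
    intro u d Φ hΦ1 hΦ2
    refine le_trans (le_of_eq ?_) (hdual u d Φ hΦ1 hΦ2)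
    rw [(int_fiber hi (fun j x => u j * x + d j - L (u j)) fun j =>
      ((hidν.const_mul _).add (integrable_const _)).sub (integrable_const _)).2]
    refine Finset.sum_congr rfl fun j _ => ?_
    have hx : Integrable (fun x : ℝ => u j * x) (ν.restrict (i ⁻¹' {j})) :=
      (hidν.const_mul _).restrict
    have hx2 : Integrable (fun x : ℝ => u j * x + d j) (ν.restrict (i ⁻¹' {j})) :=
      hx.add (integrable_const _)
    rw [integral_sub hx2 (integrable_const _),
      integral_add hx (integrable_const _), integral_const_mul, setIntegral_const,
      setIntegral_const]
    simp only [hwdef, hqdef, smul_eq_mul]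
    ring) δ hδ
  refine (weakCost_le_of_finite θ i hi w hw (fun j => (ofReal_measureReal).symm) g ga gb gc
    gd).trans ?_
  set b : F → ℝ := fun j => (∫ y, y * g j y ∂μ) / w j with hb
  set X : F → ℝ := fun j => q j / w j with hX
  have hbX : ∀ j, (q j - ∫ y, y * g j y ∂μ) / w j = X j - b j := fun j => sub_div _ _ _
  simp only [hbX] at ge
  have hI1 : Integrable (fun x => θ (x - b (i x))) ν :=
    (int_fiber hi (fun j x => θ (x - b j)) fun j => by simpa using hInt 1 (b j)).1
  have hI2 := int_fiber hi (fun j x => θ (2 * κ * (x - j))) fun j => hInt (2 * κ) j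
  have hpt : ∀ x, θ (x - b (i x)) ≤ (1 + δ * D) * θ (X (i x) - b (i x)) +
      (1 / 2 * θ (2 * κ * (x - i x)) + 1 / 2 * θ (2 * κ * (i x - X (i x)))) := by
    intro x
    have h1 := th_split hL0 hθ hD hδ hδ1 (X (i x) - b (i x)) (x - X (i x))
    have h2 := th_half hθ (κ * (x - i x)) (κ * (i x - X (i x)))
    have e1 : X (i x) - b (i x) + (x - X (i x)) = x - b (i x) := by ring
    have e2 : κ * (x - i x) + κ * (i x - X (i x)) = (1 + δ) / δ * (x - X (i x)) := by
      rw [← hκ]; ring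
    rw [e1] at h1
    rw [e2, ← mul_assoc, ← mul_assoc] at h2
    linarith
  have hjen : ∀ j, w j * θ (2 * κ * (j - X j)) ≤ ∫ x in i ⁻¹' {j}, θ (2 * κ * (x - j)) ∂ν := by
    intro j
    have hsymm : ∀ x : ℝ, θ (2 * κ * (j - x)) = θ (2 * κ * (x - j)) := by
      intro x
      rw [← th_neg hLeven hθ]; congr 1; ring
    rw [hsymm]
    have hfi : Integrable (fun x : ℝ => 2 * κ * (x - j)) (ν.restrict (i ⁻¹' {j})) :=
      ((hidν.sub (integrable_const _)).const_mul _).restrict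
    have := ConvexOn.map_set_average_le (conj_convex hθ) hθc.continuousOn isClosed_univ (hi0 j)
      (measure_ne_top _ _) (f := fun x : ℝ => 2 * κ * (x - j)) (ae_of_all _ fun x => mem_univ _)
      hfi (hInt (2 * κ) j).restrict
    rw [setAverage_eq, setAverage_eq, smul_eq_mul, smul_eq_mul] at this
    have e3 : (ν.real (i ⁻¹' {j}))⁻¹ * ∫ x in i ⁻¹' {j}, 2 * κ * (x - j) ∂ν = 2 * κ * (X j - j) := by
      have hx : Integrable (fun x : ℝ => x) (ν.restrict (i ⁻¹' {j})) := hidν.restrict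
      rw [integral_const_mul, integral_sub hx (integrable_const _), setIntegral_const]
      have := (hw j).ne'
      simp only [hX, hqdef, smul_eq_mul]
      simp only [hwdef] at this ⊢
      field_simp
    rw [e3] at this
    have h4 := mul_le_mul_of_nonneg_left this (hw j).le
    simp only [hwdef] at h4 ⊢
    rwa [mul_inv_cancel_left₀ (hw j).ne'] at h4
  have hcb : Integrable (fun x => (1 + δ * D) * θ (X (i x) - b (i x))) ν :=
    (hconsti fun j => θ (X j - b j)).const_mul _
  have hcs : Integrable (fun x => 1 / 2 * θ (2 * κ * (i x - X (i x)))) ν :=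
    (hconsti fun j => θ (2 * κ * (j - X j))).const_mul _
  have hcm : Integrable (fun x => 1 / 2 * θ (2 * κ * (x - i x))) ν := hI2.1.const_mul _
  have hfin : ∫ x, θ (x - b (i x)) ∂ν ≤ (1 + δ * D) * (K + δ) + δ := by
    refine (integral_mono hI1 (hcb.add (hcm.add hcs)) hpt).trans ?_
    have e4 : ∫ x, ((1 + δ * D) * θ (X (i x) - b (i x)) +
        (1 / 2 * θ (2 * κ * (x - i x)) + 1 / 2 * θ (2 * κ * (i x - X (i x))))) ∂ν =
        (1 + δ * D) * (∑ j, w j * θ (X j - b j)) + (1 / 2 * (∫ x, θ (2 * κ * (x - i x)) ∂ν) +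
        1 / 2 * ∑ j, w j * θ (2 * κ * (j - X j))) := by
      have hcc : Integrable (fun x => 1 / 2 * θ (2 * κ * (x - i x)) +
        1 / 2 * θ (2 * κ * (i x - X (i x)))) ν := hcm.add hcs
      rw [integral_add hcb hcc, integral_add hcm hcs, integral_const_mul,
        integral_const_mul, integral_const_mul, hconst fun j => θ (X j - b j),
        hconst fun j => θ (2 * κ * (j - X j))]
    refine e4.le.trans ?_
    have h5 : ∑ j, w j * θ (2 * κ * (j - X j)) ≤ ∫ x, θ (2 * κ * (x - i x)) ∂ν := by
      rw [hI2.2]; exact Finset.sum_le_sum fun j _ => hjen j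
    have h6 := mul_le_mul_of_nonneg_left ge.le (show 0 ≤ 1 + δ * D by positivity)
    linarith
  calc ∫⁻ x, ENNReal.ofReal (θ |x - b (i x)|) ∂ν = ∫⁻ x, ENNReal.ofReal (θ (x - b (i x))) ∂ν := by
        simp only [th_abs hLeven hθ]
    _ = ENNReal.ofReal (∫ x, θ (x - b (i x)) ∂ν) :=
        (ofReal_integral_eq_lintegral_ofReal hI1 (ae_of_all _ fun x => hθ0 _)).symm
    _ ≤ _ := ENNReal.ofReal_le_ofReal hfin

lemma core_bound {μ ν : Measure ℝ} [IsProbabilityMeasure μ]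
    [IsProbabilityMeasure ν]
    (hid : Integrable (fun x : ℝ => x) μ) (hidν : Integrable (fun x : ℝ => x) ν)
    {L θ : ℝ → ℝ} (hLconv : ConvexOn ℝ univ L)
    (hL0 : L 0 = 0) (hLnn : ∀ x, 0 ≤ L x) (hLeven : ∀ x, L (-x) = L x)
    (hθ : ∀ x, IsLUB (Set.range fun u => x * u - L u) (θ x))
    {D : ℝ} (hD : ∀ z, θ (2 * z) ≤ D * θ z) (hD0 : 0 ≤ D)
    (hInt : ∀ κ s : ℝ, Integrable (fun x => θ (κ * (x - s))) ν) (K : ℝ)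
    (hdual : ∀ (F : Finset ℝ) (_ : Nonempty F) (i : ℝ → F) (_ : Measurable i)
      (u d : F → ℝ) (Φ : ℝ → ℝ), Integrable Φ μ → (∀ x j, u j * x + d j ≤ Φ x) →
      ∫ x, (u (i x) * x + d (i x) - L (u (i x))) ∂ν ≤ K + ∫ x, Φ x ∂μ) :
    weakCost θ μ ν ≤ ENNReal.ofReal K := by
  have hθc : Continuous θ := convex_continuous (conj_convex hθ)
  have hlim : Tendsto (fun δ : ℝ => ENNReal.ofReal ((1 + δ * D) * (K + δ) + δ)) (𝓝[>] 0)
      (𝓝 (ENNReal.ofReal K)) := by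
    have : Continuous (fun δ : ℝ => ENNReal.ofReal ((1 + δ * D) * (K + δ) + δ)) :=
      ENNReal.continuous_ofReal.comp (by fun_prop)
    have h := this.tendsto 0
    simp only [zero_mul, add_zero, one_mul] at h
    exact h.mono_left nhdsWithin_le_nhds
  refine ge_of_tendsto hlim ?_
  have e2 : ∀ᶠ δ in 𝓝[>] (0:ℝ), δ < 1 :=
    (gt_mem_nhds zero_lt_one : ∀ᶠ δ in 𝓝 (0:ℝ), δ < 1).filter_mono nhdsWithin_le_nhds
  filter_upwards [e2, self_mem_nhdsWithin] with δ hδ1 hδ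
  have hδ : 0 < δ := hδ
  set κ := 2 * ((1 + δ) / δ) with hκ
  set S : ℕ → SimpleFunc ℝ ℝ := fun n =>
    SimpleFunc.approxOn (fun x : ℝ => x) measurable_id univ 0 (mem_univ 0) n with hS
  have hle : ∀ n x, |x - S n x| ≤ |x| := by
    intro n x
    have := SimpleFunc.edist_approxOn_le (f := fun x : ℝ => x) measurable_id
      (mem_univ (0:ℝ)) x n
    rw [edist_dist, edist_dist] at this
    have := (ENNReal.ofReal_le_ofReal_iff dist_nonneg).1 this
    rw [dist_comm, Real.dist_eq, Real.dist_eq, zero_sub, abs_neg] at this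
    exact this
  have htend : ∀ x, Tendsto (fun n => S n x) atTop (𝓝 x) := fun x =>
    SimpleFunc.tendsto_approxOn (f := fun x : ℝ => x) measurable_id (mem_univ (0:ℝ))
      (by simp)
  have hDCT : Tendsto (fun n => ∫ x, θ (κ * (x - S n x)) ∂ν) atTop (𝓝 (∫ x, (0:ℝ) ∂ν)) := by
    refine tendsto_integral_of_dominated_convergence (fun x => θ (κ * x))
      (fun n => ?_) (by simpa using hInt κ 0) (fun n => ae_of_all _ fun x => ?_)
      (ae_of_all _ fun x => ?_)
    · have := (S n).measurable
      exact (hθc.measurable.comp ((measurable_id.sub this).const_mul κ)).aestronglyMeasurable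
    · rw [Real.norm_eq_abs, abs_of_nonneg (th_nonneg hL0 hθ _)]
      apply th_mono hL0 hLnn hLeven hθ
      rw [abs_mul κ, abs_mul κ]
      exact mul_le_mul_of_nonneg_left (hle n x) (abs_nonneg _)
    · have h1 : Tendsto (fun n => θ (κ * (x - S n x))) atTop (𝓝 (θ (κ * (x - x)))) :=
        (hθc.tendsto _).comp ((tendsto_const_nhds.sub (htend x)).const_mul κ)
      simpa [th_zero hL0 hLnn hθ] using h1
  rw [integral_zero] at hDCT
  obtain ⟨n, hn⟩ := (hDCT.eventually (gt_mem_nhds hδ)).exists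
  obtain ⟨F, i, hne, hi, hi0, hae⟩ := exists_disc (ν := ν) (S n)
  refine disc_bound hid hidν hLconv hL0 hLeven hθ hD hD0 hInt K i hi hi0 (hdual F hne i hi) hδ
    hδ1.le ?_
  refine lt_of_eq_of_lt (integral_congr_ae ?_) hn
  filter_upwards [hae] with x hx
  rw [hx]
/-- **Proposition 3.1, (ii) ⟹ (i).** If `μ` has all exponential moments finite and satisfies
the convex log-Sobolev inequality with cost `H` and constant `c > 0`, then `μ` satisfies the
weak transport-entropy inequality `T̄⁻(H*(a·))` with `a = ((α−1)/A)^{1/α} c⁻¹`. -/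
theorem convex_logSobolev_implies_weakTransport
    (H : ℝ → ℝ) (t₀ : ℝ) (ht₀ : 0 < t₀)
    (hHnn : ∀ x, 0 ≤ H x)
    (hHsymm : ∀ x, H (-x) = H x)
    (hHconv : ConvexOn ℝ Set.univ H)
    (hHquad : ∀ x : ℝ, |x| ≤ 2 * t₀ → H x = x ^ 2 / 4)
    (Hstar : ℝ → ℝ)
    (hHstar : ∀ x, IsLUB (Set.range fun y => x * y - H y) (Hstar x))
    (hsuper : Tendsto (fun x => Hstar x / x) atTop atTop)
    (A α : ℝ) (hA : 1 ≤ A) (hα₁ : 1 < α) (hα₂ : α ≤ 2)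
    (hscale : ∀ x : ℝ, ∀ s ∈ Set.Icc (0:ℝ) 1, H (s * x) ≤ A * s ^ α * H x)
    (μ : Measure ℝ) [IsProbabilityMeasure μ]
    (hexp : ∀ s > (0:ℝ), Integrable (fun x => Real.exp (s * |x|)) μ)
    (c : ℝ) (hc : 0 < c)
    (hLSI : ∀ φ : ℝ → ℝ, ContDiff ℝ (⊤ : ℕ∞) φ → ConvexOn ℝ Set.univ φ →
      (∃ K : ℝ≥0, LipschitzWith K φ) →
      Ent μ (fun x => Real.exp (φ x)) ≤
        ∫⁻ x, ENNReal.ofReal (H (c * deriv φ x) * Real.exp (φ x)) ∂μ) :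
    Tminus (fun t => Hstar ((((α - 1) / A) ^ (1 / α) * c⁻¹) * t)) μ := by
  set a : ℝ := ((α - 1) / A) ^ (1 / α) * c⁻¹ with ha
  have hA0 : 0 < A := by linarith
  have hα0 : 0 < α := by linarith
  have hB0 : 0 < (α - 1) / A := div_pos (by linarith) hA0
  have hB1 : (α - 1) / A ≤ 1 := (div_le_one hA0).2 (by linarith)
  set β : ℝ := ((α - 1) / A) ^ (1 / α) with hβ
  have hβ0 : 0 < β := Real.rpow_pos_of_pos hB0 _
  have hβ1 : β ≤ 1 := Real.rpow_le_one hB0.le hB1 (by positivity)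
  have hβα : β ^ α = (α - 1) / A := by
    rw [hβ, ← Real.rpow_mul hB0.le, one_div_mul_cancel hα0.ne', Real.rpow_one]
  have ha0 : 0 < a := mul_pos hβ0 (inv_pos.2 hc)
  set L : ℝ → ℝ := fun u => H (a⁻¹ * u) with hL
  set θ : ℝ → ℝ := fun t => Hstar (a * t) with hθdef
  have hHcont : Continuous H := convex_continuous hHconv
  have hL0 : L 0 = 0 := by
    simp only [hL, mul_zero]
    rw [hHquad 0 (by simp; linarith)]; norm_num
  have hLnn : ∀ x, 0 ≤ L x := fun x => hHnn _
  have hLeven : ∀ x, L (-x) = L x := fun x => by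
    simp only [hL, mul_neg]; exact hHsymm _
  have hLconv : ConvexOn ℝ univ L := by
    refine ⟨convex_univ, fun x _ y _ s t hs ht hst => ?_⟩
    have := hHconv.2 (mem_univ (a⁻¹ * x)) (mem_univ (a⁻¹ * y)) hs ht hst
    simp only [smul_eq_mul] at this
    simp only [hL, smul_eq_mul]
    convert this using 2
    ring
  have hθ : ∀ x, IsLUB (Set.range fun u => x * u - L u) (θ x) := by
    intro x
    have h := hHstar (a * x)
    convert h using 1
    ext v
    constructor
    · rintro ⟨u, rfl⟩
      refine ⟨a⁻¹ * u, ?_⟩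
      simp only [hL]
      field_simp
    · rintro ⟨u, rfl⟩
      refine ⟨a * u, ?_⟩
      simp only [hL]
      rw [inv_mul_cancel_left₀ ha0.ne']
      ring
  have hsc : ∀ x : ℝ, ∀ s ∈ Icc (0:ℝ) 1, L (s * x) ≤ A * s ^ α * L x := by
    intro x s hs
    have := hscale (a⁻¹ * x) s hs
    simp only [hL]
    convert this using 2
    ring
  have hdb := th_doubling hθ hA hα₁ hsc
  have hHL : ∀ k ∈ Ioc (0:ℝ) 1, ∀ x, H (c * (k * x)) ≤ (α - 1) * k ^ α * L x := by
    intro k hk x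
    have h1 := hscale (a⁻¹ * x) (k * β) ⟨by have := hk.1; positivity, by
      have := mul_le_one₀ hk.2 hβ0.le hβ1; exact this⟩
    have e1 : k * β * (a⁻¹ * x) = c * (k * x) := by
      rw [ha]
      field_simp
    have e2 : A * (k * β) ^ α = (α - 1) * k ^ α := by
      rw [Real.mul_rpow hk.1.le hβ0.le, hβα]
      field_simp
    rw [e1, e2] at h1
    exact h1
  have hlsi := lsi_real hHnn hHcont hexp hLSI
  have hid : Integrable (fun x : ℝ => x) μ := by
    refine integrable_of_exp_bound hexp (by fun_prop) 1 1 one_pos fun x => ?_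
    have := linear_le_exp (C := 0) (K := 1) (x := x) le_rfl zero_le_one
    simpa using this
  intro ν hν hidν
  unfold relEnt
  split_ifs with hcase
  swap
  · exact le_top
  obtain ⟨hac, hllr⟩ := hcase
  set m : ℝ := ∫ y, y ∂μ with hm
  have hmgf : ∀ u, Integrable (fun x => Real.exp (u * x - u * m - L u)) μ ∧
      ∫ x, Real.exp (u * x - u * m - L u) ∂μ ≤ 1 := by
    intro u
    obtain ⟨h1, h2⟩ := hj_sel (ι := Unit) hexp hα₁ hα₂ hLconv hLnn (Hc := fun x => H (c * x)) hHL
      hlsi (fun _ => u) (fun _ => -(u * m)) (fun x => u * x - u * m - L u)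
      (fun x => u * x - u * m) (by fun_prop) (fun x => ⟨(), le_of_eq (by ring)⟩)
      ((hid.const_mul u).sub (integrable_const _)) (fun x _ => le_of_eq (by ring))
    refine ⟨h1, ?_⟩
    rw [integral_sub (hid.const_mul u) (integrable_const _), integral_const_mul, ← hm] at h2
    have h3 : Real.log (∫ x, Real.exp (u * x - u * m - L u) ∂μ) ≤ 0 := by simpa using h2
    have h4 : 0 < ∫ x, Real.exp (u * x - u * m - L u) ∂μ := integral_exp_pos h1
    rw [← Real.exp_log h4]
    exact Real.exp_le_one_iff.2 h3
  have hθc : Continuous θ := convex_continuous (conj_convex hθ)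
  have hY : Integrable (fun x => θ (x - m)) ν :=
    th_int_nu (by fun_prop) (fun x => th_nonneg hL0 hθ _) hac hllr
      (th_exp_int hL0 hLnn hLeven hθ m hmgf)
  have hall := th_int_all hL0 hLnn hLeven hθ hdb m hY
  have hInt : ∀ κ s : ℝ, Integrable (fun x => θ (κ * (x - s))) ν := by
    intro κ s
    refine (((hall (2 * κ)).const_mul (1 / 2)).add
      (integrable_const (1 / 2 * θ (2 * (-(κ * s)))))).mono' (by fun_prop)
      (ae_of_all _ fun x => ?_)
    rw [Real.norm_eq_abs, abs_of_nonneg (th_nonneg hL0 hθ _)]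
    have h1 := th_half hθ (κ * x) (-(κ * s))
    have e : κ * x + -(κ * s) = κ * (x - s) := by ring
    rw [e, ← mul_assoc 2 κ x] at h1
    exact h1
  obtain ⟨D, hD0, hD⟩ := hdb 2 one_le_two
  refine core_bound hid hidν hLconv hL0 hLnn hLeven hθ hD hD0 hInt _ ?_
  intro F hF i hi u d Φ hΦ1 hΦ2
  have hψm : Measurable (fun x => u (i x) * x + d (i x) - L (u (i x))) :=
    meas_sel (f := fun j x => u j * x + d j - L (u j)) (fun j => by fun_prop) hi
  obtain ⟨h1, h2⟩ := hj_sel (ι := F) hexp hα₁ hα₂ hLconv hLnn (Hc := fun x => H (c * x)) hHL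
    hlsi u d (fun x => u (i x) * x + d (i x) - L (u (i x))) Φ hψm (fun x => ⟨i x, le_rfl⟩) hΦ1 hΦ2
  have h3 := (int_fiber hi (fun j x => u j * x + d j - L (u j)) fun j =>
      ((hidν.const_mul _).add (integrable_const _)).sub (integrable_const _)).1
  have h4 := gibbs hac hllr h3 h1
  linarith
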